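/- arXiv:2605.27623 — 2 statements merged into one kernel-verified Lean document; each statement's English description precedes it below -/
import Mathlib

section
/- Let d ≥ 3 be an integer. For a general pencil of plane curves of degree d over ℂ and any base point p of the pencil (a common zero of the two spanning forms), the number of members C of the pencil such that C is smooth at p and the tangent line to C at p is tangent to C at a second point distinct from p is exactly (d − 3)(d + 4) = d² + d − 12. -/
noncomputable section

/-- The restriction of the form `F` to the line through `[v]` and `[w]`,
parametrized by `t ↦ v + t • w`, as a polynomial in `t`. -/
def linePoly (F : MvPolynomial (Fin 3) ℂ) (v w : Fin 3 → ℂ) : Polynomial ℂ :=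
  MvPolynomial.aeval (fun i => Polynomial.C (v i) + Polynomial.X * Polynomial.C (w i)) F

/-- The line through the two (projectively distinct) points `[v]`, `[w]` has contact
order at least `m` with the curve `{F = 0}` at the point `[v]`. -/
def ContactLE (F : MvPolynomial (Fin 3) ℂ) (v w : Fin 3 → ℂ) (m : ℕ) : Prop :=
  (Polynomial.X : Polynomial ℂ) ^ m ∣ linePoly F v w

/-- The member of the pencil spanned by `F` and `G` corresponding to `c ∈ ℙ¹`. -/
def pencilMember (F G : MvPolynomial (Fin 3) ℂ) (c : Projectivization ℂ (Fin 2 → ℂ)) :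
    MvPolynomial (Fin 3) ℂ :=
  c.rep 0 • F + c.rep 1 • G

/-- The coefficient vector of a pair of forms. -/
def coeffs2 (F G : MvPolynomial (Fin 3) ℂ) : (Fin 3 →₀ ℕ) ⊕ (Fin 3 →₀ ℕ) → ℂ :=
  Sum.elim (fun m => MvPolynomial.coeff m F) (fun m => MvPolynomial.coeff m G)

/-- The set of members `C` of the pencil spanned by `F` and `G` that are smooth at the
point `[v]` and whose tangent line at `[v]` is tangent to `C` at a second point `[u]`
distinct from `[v]`.  (A point `[u]` lies on the tangent line iff the gradient of `C`
at `v` annihilates `u`; since `[v]` is on `C`, the tangent line is spanned by `v` and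
such a `u`, so the contact condition at `[u]` is taken along the direction `v`.) -/
def membersWithSecondTangency (F G : MvPolynomial (Fin 3) ℂ) (v : Fin 3 → ℂ) :
    Set (Projectivization ℂ (Fin 2 → ℂ)) :=
  {c | (∃ i : Fin 3, MvPolynomial.eval v (MvPolynomial.pderiv i (pencilMember F G c)) ≠ 0) ∧
    ∃ u : Fin 3 → ℂ,
      (∑ i, MvPolynomial.eval v (MvPolynomial.pderiv i (pencilMember F G c)) * u i) = 0 ∧
      LinearIndependent ℂ ![v, u] ∧ ContactLE (pencilMember F G c) u v 2}

namespace SecondTangency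
open Polynomial

lemma natDegree_det_le {ι : Type*} [Fintype ι] [DecidableEq ι] {A : Type*} [CommRing A]
    (N : Matrix ι ι A[X]) (b : ι → ℕ) (h : ∀ i j, (N i j).natDegree ≤ b j) :
    N.det.natDegree ≤ ∑ j, b j := by
  rw [Matrix.det_apply]
  refine natDegree_sum_le_of_forall_le _ _ fun σ _ => ?_
  refine (natDegree_smul_le _ _).trans ?_
  exact (natDegree_prod_le _ _).trans (Finset.sum_le_sum fun j _ => h _ _)

/-- discriminant of formal degree `n`: the resultant of the two homogeneous partials -/
def D {A : Type*} [CommRing A] (n : ℕ) (p : A[X]) : A :=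
  resultant (derivative p) ((n : A[X]) * p - X * derivative p) (n - 1) (n - 1)

lemma D_map {A B : Type*} [CommRing A] [CommRing B] (f : A →+* B) (n : ℕ) (p : A[X]) :
    D n (p.map f) = f (D n p) := by
  unfold D
  have h := resultant_map_map (derivative p) ((n : A[X]) * p - X * derivative p) (n - 1) (n - 1) f
  rw [← h, Polynomial.map_sub, Polynomial.map_mul, Polynomial.map_mul, map_X,
    Polynomial.map_natCast, Polynomial.derivative_map]

lemma resultant_zero_of_root {A : Type*} [CommRing A] (f g : A[X]) (m n : ℕ) (x : A)
    (hf : f.natDegree ≤ m) (hg : g.natDegree ≤ n) (H : m ≠ 0 ∨ n ≠ 0)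
    (hfx : f.eval x = 0) (hgx : g.eval x = 0) : resultant f g m n = 0 := by
  obtain ⟨p, q, -, -, h⟩ := exists_mul_add_mul_eq_C_resultant f g hf hg H
  have := congrArg (eval x) h
  simpa [hfx, hgx] using this.symm

lemma resultant_zero_of_lead {A : Type*} [CommRing A] (f g : A[X]) (m n : ℕ)
    (hf : f.natDegree ≤ m) (hg : g.natDegree ≤ n) (hm : m ≠ 0) (hn : n ≠ 0)
    (hfx : f.coeff m = 0) (hgx : g.coeff n = 0) : resultant f g m n = 0 := by
  apply resultant_eq_zero_of_lt_lt
  · rcases hf.lt_or_eq with h | h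
    · exact h
    · subst h
      have : f = 0 := by simpa using hfx
      simp [this] at hm
  · rcases hg.lt_or_eq with h | h
    · exact h
    · subst h
      have : g = 0 := by simpa using hgx
      simp [this] at hn

lemma resultant_zero_iff_aux (f g : ℂ[X]) (m : ℕ) (hf : f.natDegree ≤ m) (hg : g.natDegree ≤ m)
    (h : f.coeff m ≠ 0) :
    resultant f g m m = 0 ↔ ∃ s, f.eval s = 0 ∧ g.eval s = 0 := by
  have hm : f.natDegree = m := le_antisymm hf (le_natDegree_of_ne_zero h)
  have hf0 : f ≠ 0 := by rintro rfl; simp at h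
  obtain ⟨k, hk⟩ := Nat.exists_eq_add_of_le hg
  have e : resultant f g m m = f.coeff m ^ k * resultant f g := by
    rw [hm]
    conv_lhs => rw [show resultant f g m m = resultant f g m (g.natDegree + k) by rw [← hk]]
    exact resultant_add_right_deg _ _ _ _ _ le_rfl
  rw [e, mul_eq_zero, or_iff_right (pow_ne_zero _ h), resultant_eq_zero_iff,
    isCoprime_iff_aeval_ne_zero_of_isAlgClosed ℂ ℂ]
  simp only [hf0, ne_eq, not_false_eq_true, true_or, true_and, coe_aeval_eq_eval]
  push Not
  rfl

lemma resultant_zero_iff (f g : ℂ[X]) (m : ℕ) (hf : f.natDegree ≤ m) (hg : g.natDegree ≤ m)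
    (h : f.coeff m ≠ 0 ∨ g.coeff m ≠ 0) :
    resultant f g m m = 0 ↔ ∃ s, f.eval s = 0 ∧ g.eval s = 0 := by
  rcases h with h | h
  · exact resultant_zero_iff_aux f g m hf hg h
  · rw [resultant_comm, mul_eq_zero, or_iff_right (by simp), resultant_zero_iff_aux g f m hg hf h]
    simp only [and_comm]

lemma natDegree_f2_le {A : Type*} [CommRing A] (n : ℕ) (p : A[X]) (hp : p.natDegree ≤ n) :
    ((n : A[X]) * p - X * derivative p).natDegree ≤ n - 1 := by
  rw [natDegree_le_iff_coeff_eq_zero]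
  intro N hN
  obtain ⟨N, rfl⟩ : ∃ k, N = k + 1 := ⟨N - 1, by omega⟩
  rw [coeff_sub, coeff_X_mul, coeff_derivative, coeff_natCast_mul]
  rcases (show n ≤ N + 1 by omega).lt_or_eq with h | h
  · rw [coeff_eq_zero_of_natDegree_lt (hp.trans_lt h)]; simp
  · subst h; push_cast; ring

lemma D_eq_zero_iff (n : ℕ) (hn : 1 ≤ n) (p : ℂ[X]) (hp : p.natDegree ≤ n)
    (h : p.coeff n ≠ 0 ∨ p.coeff (n - 1) ≠ 0) :
    D n p = 0 ↔ ∃ s, p.eval s = 0 ∧ (derivative p).eval s = 0 := by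
  unfold D
  rw [resultant_zero_iff _ _ _ ((natDegree_derivative_le _).trans (by omega))
    (natDegree_f2_le n p hp)]
  · have : (n : ℂ) ≠ 0 := by exact_mod_cast (by omega : n ≠ 0)
    refine exists_congr fun s => ?_
    constructor
    · rintro ⟨h1, h2⟩
      simp [h1, this] at h2
      exact ⟨h2, h1⟩
    · rintro ⟨h1, h2⟩
      simp [h1, h2]
  · obtain ⟨n, rfl⟩ : ∃ k, n = k + 1 := ⟨n - 1, by omega⟩
    rcases h with h | h
    · left
      simp only [Nat.add_sub_cancel, coeff_derivative]
      exact mul_ne_zero h (by exact_mod_cast (by omega : n + 1 ≠ 0))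
    · right
      simp only [Nat.add_sub_cancel] at h ⊢
      rw [coeff_sub, coeff_natCast_mul]
      cases n with
      | zero => simpa using h
      | succ n =>
        rw [coeff_X_mul, coeff_derivative]
        push_cast
        have : ((n : ℂ) + 1 + 1) * p.coeff (n + 1) - p.coeff (n + 1) * (n + 1) = p.coeff (n + 1) := by
          ring
        rw [this]; exact h

lemma resultant_comp_C_mul_X (f g : ℂ[X]) (m : ℕ) (b : ℂ) (hb : b ≠ 0) :
    resultant (f.comp (C b * X)) (g.comp (C b * X)) m m = b ^ (m * m) * resultant f g m m := by
  have key : sylvester (f.comp (C b * X)) (g.comp (C b * X)) m m *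
      Matrix.diagonal (fun j : Fin (m + m) => j.addCases (fun j₁ : Fin m => b ^ (j₁ : ℕ))
        (fun j₁ : Fin m => b ^ (j₁ : ℕ))) =
      Matrix.diagonal (fun i : Fin (m + m) => b ^ (i : ℕ)) * sylvester f g m m := by
    ext i j
    rw [Matrix.mul_diagonal, Matrix.diagonal_mul]
    induction j using Fin.addCases with
    | left j =>
      simp only [sylvester, Matrix.of_apply, Fin.addCases_left, comp_C_mul_X_coeff]
      split_ifs with h
      · have : (i : ℕ) = (i - j) + j := by have := h.1; omega
        conv_rhs => rw [this, pow_add, Nat.add_sub_cancel]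
        ring
      · simp
    | right j =>
      simp only [sylvester, Matrix.of_apply, Fin.addCases_right, comp_C_mul_X_coeff]
      split_ifs with h
      · have : (i : ℕ) = (i - j) + j := by have := h.1; omega
        conv_rhs => rw [this, pow_add, Nat.add_sub_cancel]
        ring
      · simp
  have := congrArg Matrix.det key
  rw [Matrix.det_mul, Matrix.det_mul, Matrix.det_diagonal, Matrix.det_diagonal,
    Fin.prod_univ_add, Fin.prod_univ_add] at this
  simp only [Fin.addCases_left, Fin.addCases_right, Fin.val_castAdd, Fin.val_natAdd, pow_add,
    Finset.prod_mul_distrib, Finset.prod_const, Finset.card_univ, Fintype.card_fin] at this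
  set T := ∏ i : Fin m, b ^ (i : ℕ) with hT
  have hT0 : T ≠ 0 := Finset.prod_ne_zero_iff.mpr fun i _ => pow_ne_zero _ hb
  unfold resultant
  apply mul_right_cancel₀ (mul_ne_zero hT0 hT0)
  rw [this, pow_mul]; ring

/-- scaling behaviour of `D` -/
lemma D_scale (n : ℕ) (p : ℂ[X]) (a b : ℂ) (hb : b ≠ 0) :
    D n (C a * p.comp (C b * X)) =
      a ^ (2 * (n - 1)) * b ^ ((n - 1) * (n - 1) + (n - 1)) * D n p := by
  unfold D
  have e1 : derivative (C a * p.comp (C b * X)) = C (a * b) * (derivative p).comp (C b * X) := by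
    simp [derivative_comp]; ring
  have e2 : (n : ℂ[X]) * (C a * p.comp (C b * X)) - X * (C (a * b) * (derivative p).comp (C b * X))
      = C a * ((n : ℂ[X]) * p - X * derivative p).comp (C b * X) := by
    simp; ring
  rw [e1, e2, resultant_C_mul_left, resultant_C_mul_right, resultant_comp_C_mul_X _ _ _ _ hb]
  ring

lemma refl_lemma (p q : ℂ[X]) (M : ℕ) (h : ∀ s : ℂ, s ≠ 0 → p.eval s = s ^ M * q.eval s⁻¹) :
    p.natDegree ≤ M ∧ ∀ i ≤ M, p.coeff i = q.coeff (M - i) := by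
  have key : X ^ q.natDegree * p = reflect (M + q.natDegree) q := by
    apply Polynomial.eq_of_infinite_eval_eq
    refine Set.Infinite.mono (s := {s : ℂ | s ≠ 0}) ?_ (Set.Infinite.mono (s := {0}ᶜ) (by
      intro s hs; simpa using hs) (Set.finite_singleton 0).infinite_compl)
    intro s hs
    have hs : s ≠ 0 := hs
    let _ : Invertible s⁻¹ := invertibleOfNonzero (inv_ne_zero hs)
    have := eval₂_reflect_mul_pow (RingHom.id ℂ) s⁻¹ (M + q.natDegree) q (by omega)
    simp only [invOf_eq_inv, inv_inv, eval₂_id] at this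
    simp only [Set.mem_ofPred_eq, eval_mul, eval_pow, eval_X]
    rw [h s hs, ← this, pow_add, inv_pow, inv_pow]
    field_simp
  have hc : ∀ i, p.coeff i = q.coeff (revAt (M + q.natDegree) (i + q.natDegree)) := by
    intro i
    rw [← coeff_reflect, ← key, coeff_X_pow_mul]
  constructor
  · rw [natDegree_le_iff_coeff_eq_zero]
    intro N hN
    rw [hc, revAt_eq_self_of_lt (by omega), coeff_eq_zero_of_natDegree_lt (by omega)]
  · intro i hi
    rw [hc, revAt_le (by omega)]
    congr 1; omega

end SecondTangency
namespace SecondTangency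
open Polynomial

/-- the dimension argument -/
lemma exists_dvd_aeval {σ : Type} [Finite σ] (e : σ → MvPolynomial σ ℂ) (D : MvPolynomial σ ℂ)
    (hD : D ≠ 0) : ∃ Q : MvPolynomial σ ℂ, Q ≠ 0 ∧ D ∣ MvPolynomial.aeval e Q := by
  have hdep : ¬ AlgebraicIndependent ℂ (fun o : Option σ => o.elim D e) := by
    intro h
    have h1 := h.cardinalMk_le_trdeg
    rw [MvPolynomial.trdeg_of_isDomain] at h1
    have := Fintype.ofFinite σ
    simp only [Cardinal.mk_fintype, Fintype.card_option, Cardinal.lift_natCast] at h1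
    have : Fintype.card σ + 1 ≤ Fintype.card σ := by exact_mod_cast h1
    omega
  rw [algebraicIndependent_iff] at hdep
  push Not at hdep
  obtain ⟨q, hq, hq0⟩ := hdep
  set p := MvPolynomial.optionEquivLeft ℂ σ q with hp
  have hp0 : p ≠ 0 := by simpa [hp] using hq0
  have hqp : ∀ q : MvPolynomial (Option σ) ℂ,
      MvPolynomial.aeval (fun o : Option σ => o.elim D e) q =
      eval₂ (MvPolynomial.aeval e : MvPolynomial σ ℂ →ₐ[ℂ] MvPolynomial σ ℂ).toRingHom D
        (MvPolynomial.optionEquivLeft ℂ σ q) := by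
    intro q
    induction q using MvPolynomial.induction_on with
    | C a => simp [MvPolynomial.optionEquivLeft_apply]
    | add p q h1 h2 => rw [map_add, map_add, eval₂_add, h1, h2]
    | mul_X p o h =>
      rw [map_mul, map_mul, eval₂_mul, h]
      cases o <;> simp [MvPolynomial.optionEquivLeft_apply]
  rw [hqp, ← hp] at hq
  obtain ⟨r, hr, hr2⟩ := Polynomial.exists_eq_pow_rootMultiplicity_mul_and_not_dvd p hp0 0
  rw [hr] at hq
  simp only [map_zero, sub_zero, eval₂_mul, eval₂_pow, eval₂_X] at hq hr2
  have hq2 := (mul_eq_zero.mp hq).resolve_left (pow_ne_zero _ hD)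
  rw [X_dvd_iff] at hr2
  refine ⟨r.coeff 0, hr2, ?_⟩
  rw [← divX_mul_X_add r] at hq2
  simp only [eval₂_add, eval₂_mul, eval₂_X, eval₂_C] at hq2
  have h3 : MvPolynomial.aeval e (r.coeff 0) = -(eval₂ (MvPolynomial.aeval e :
      MvPolynomial σ ℂ →ₐ[ℂ] MvPolynomial σ ℂ).toRingHom D r.divX * D) :=
    eq_neg_of_add_eq_zero_right hq2
  rw [h3, dvd_neg]
  exact dvd_mul_left _ _

/-- restriction to a line, over any ring -/
def lp {A : Type*} [CommRing A] (F : MvPolynomial (Fin 3) A) (v w : Fin 3 → A) : A[X] :=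
  MvPolynomial.aeval (fun i => C (v i) + X * C (w i)) F

lemma lp_map {A B : Type*} [CommRing A] [CommRing B] (f : A →+* B)
    (F : MvPolynomial (Fin 3) A) (v w : Fin 3 → A) :
    (lp F v w).map f = lp (MvPolynomial.map f F) (f ∘ v) (f ∘ w) := by
  unfold lp
  induction F using MvPolynomial.induction_on with
  | C a => simp
  | add p q h1 h2 => simp only [map_add, Polynomial.map_add, h1, h2]
  | mul_X p i h =>
    rw [map_mul, map_mul, map_mul, Polynomial.map_mul, h]
    simp

lemma lp_eval {A : Type*} [CommRing A] (F : MvPolynomial (Fin 3) A) (v w : Fin 3 → A) (s : A) :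
    (lp F v w).eval s = MvPolynomial.eval (fun i => v i + s * w i) F := by
  unfold lp
  induction F using MvPolynomial.induction_on with
  | C a => simp
  | add p q h1 h2 => simp only [map_add, Polynomial.eval_add, h1, h2]
  | mul_X p i h =>
    rw [map_mul, map_mul, Polynomial.eval_mul, h]
    simp; ring

/-- combination having vanishing `d-1` coefficient -/
def gg {A : Type*} [CommRing A] (d : ℕ) (F G : MvPolynomial (Fin 3) A) (w v : Fin 3 → A) : A[X] :=
  C ((lp G w v).coeff (d - 1)) * lp F w v - C ((lp F w v).coeff (d - 1)) * lp G w v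

lemma gg_map {A B : Type*} [CommRing A] [CommRing B] (f : A →+* B) (d : ℕ)
    (F G : MvPolynomial (Fin 3) A) (w v : Fin 3 → A) :
    (gg d F G w v).map f = gg d (MvPolynomial.map f F) (MvPolynomial.map f G) (f ∘ w) (f ∘ v) := by
  simp only [gg, ← lp_map, coeff_map, Polynomial.map_sub, Polynomial.map_mul, map_C]

/-- the universal polynomial in the slope -/
def gx {A : Type*} [CommRing A] (d : ℕ) (F G : MvPolynomial (Fin 3) A) (v : Fin 3 → A) : A[X][X] :=
  gg d (MvPolynomial.map C F) (MvPolynomial.map C G) ![1, X, 0] (C ∘ v)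

def gy {A : Type*} [CommRing A] (d : ℕ) (F G : MvPolynomial (Fin 3) A) (v : Fin 3 → A) : A[X][X] :=
  gg d (MvPolynomial.map C F) (MvPolynomial.map C G) ![X, 1, 0] (C ∘ v)

lemma gx_eval {A : Type*} [CommRing A] (d : ℕ) (F G : MvPolynomial (Fin 3) A) (v : Fin 3 → A)
    (x : A) : (gx d F G v).map (evalRingHom x) = gg d F G ![1, x, 0] v := by
  unfold gx
  rw [gg_map, MvPolynomial.map_map, MvPolynomial.map_map]
  have h1 : (evalRingHom x).comp C = RingHom.id A := by ext; simp
  have h2 : (⇑(evalRingHom x) ∘ ![1, X, 0] : Fin 3 → A) = ![1, x, 0] := by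
    ext i; fin_cases i <;> simp
  have h3 : (⇑(evalRingHom x) ∘ (C ∘ v) : Fin 3 → A) = v := by ext i; simp
  rw [h1, h2, h3, MvPolynomial.map_id, MvPolynomial.map_id]

lemma gy_eval {A : Type*} [CommRing A] (d : ℕ) (F G : MvPolynomial (Fin 3) A) (v : Fin 3 → A)
    (x : A) : (gy d F G v).map (evalRingHom x) = gg d F G ![x, 1, 0] v := by
  unfold gy
  rw [gg_map, MvPolynomial.map_map, MvPolynomial.map_map]
  have h1 : (evalRingHom x).comp C = RingHom.id A := by ext; simp
  have h2 : (⇑(evalRingHom x) ∘ ![X, 1, 0] : Fin 3 → A) = ![x, 1, 0] := by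
    ext i; fin_cases i <;> simp
  have h3 : (⇑(evalRingHom x) ∘ (C ∘ v) : Fin 3 → A) = v := by ext i; simp
  rw [h1, h2, h3, MvPolynomial.map_id, MvPolynomial.map_id]

lemma gx_map {A B : Type*} [CommRing A] [CommRing B] (f : A →+* B) (d : ℕ)
    (F G : MvPolynomial (Fin 3) A) (v : Fin 3 → A) :
    (gx d F G v).map (mapRingHom f) =
      gx d (MvPolynomial.map f F) (MvPolynomial.map f G) (f ∘ v) := by
  unfold gx
  rw [gg_map, MvPolynomial.map_map, MvPolynomial.map_map, MvPolynomial.map_map,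
    MvPolynomial.map_map]
  have h1 : (mapRingHom f).comp C = C.comp f := by ext; simp
  have h2 : (⇑(mapRingHom f) ∘ ![1, X, 0] : Fin 3 → B[X]) = ![1, X, 0] := by
    ext i; fin_cases i <;> simp
  have h3 : (⇑(mapRingHom f) ∘ (C ∘ v) : Fin 3 → B[X]) = C ∘ (f ∘ v) := by ext i; simp
  rw [h1, h2, h3]

/-- the discriminant polynomial -/
def RR {A : Type*} [CommRing A] (d : ℕ) (F G : MvPolynomial (Fin 3) A) (v : Fin 3 → A) : A[X] :=
  D (d - 2) (gx d F G v)

/-- The four genericity conditions. -/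
def D1 {A : Type*} [CommRing A] (d : ℕ) (F G : MvPolynomial (Fin 3) A) (v : Fin 3 → A) : A :=
  (lp F ![1, 0, 0] v).coeff (d - 1) * (lp G ![0, 1, 0] v).coeff (d - 1) -
  (lp F ![0, 1, 0] v).coeff (d - 1) * (lp G ![1, 0, 0] v).coeff (d - 1)

def D2 {A : Type*} [CommRing A] (d : ℕ) (F G : MvPolynomial (Fin 3) A) (v : Fin 3 → A) : A :=
  resultant ((gx d F G v).coeff (d - 2)) ((gx d F G v).coeff (d - 3)) 3 4

def D3 {A : Type*} [CommRing A] (d : ℕ) (F G : MvPolynomial (Fin 3) A) (v : Fin 3 → A) : A :=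
  (RR d F G v).coeff ((d - 3) * (d + 4))

def D4 {A : Type*} [CommRing A] (d : ℕ) (F G : MvPolynomial (Fin 3) A) (v : Fin 3 → A) : A :=
  resultant (RR d F G v) (derivative (RR d F G v)) ((d - 3) * (d + 4)) ((d - 3) * (d + 4) - 1)

section
variable {A B : Type*} [CommRing A] [CommRing B] (f : A →+* B) (d : ℕ)
    (F G : MvPolynomial (Fin 3) A) (v : Fin 3 → A)

lemma RR_map : (RR d F G v).map f =
    RR d (MvPolynomial.map f F) (MvPolynomial.map f G) (f ∘ v) := by
  unfold RR
  rw [← gx_map, D_map, coe_mapRingHom]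

lemma RR_eval (x : A) : (RR d F G v).eval x = D (d - 2) (gg d F G ![1, x, 0] v) := by
  unfold RR
  rw [← gx_eval, D_map]; rfl

lemma D1_map : f (D1 d F G v) = D1 d (MvPolynomial.map f F) (MvPolynomial.map f G) (f ∘ v) := by
  have h1 : (⇑f ∘ ![1, 0, 0] : Fin 3 → B) = ![1, 0, 0] := by
    ext i; fin_cases i <;> simp
  have h2 : (⇑f ∘ ![0, 1, 0] : Fin 3 → B) = ![0, 1, 0] := by
    ext i; fin_cases i <;> simp
  simp only [D1, map_sub, map_mul, ← coeff_map, lp_map, h1, h2]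

lemma D2_map : f (D2 d F G v) = D2 d (MvPolynomial.map f F) (MvPolynomial.map f G) (f ∘ v) := by
  unfold D2
  rw [← gx_map, coeff_map, coeff_map]
  exact (resultant_map_map _ _ _ _ f).symm

lemma D3_map : f (D3 d F G v) = D3 d (MvPolynomial.map f F) (MvPolynomial.map f G) (f ∘ v) := by
  unfold D3
  rw [← RR_map, coeff_map]

lemma D4_map : f (D4 d F G v) = D4 d (MvPolynomial.map f F) (MvPolynomial.map f G) (f ∘ v) := by
  unfold D4
  rw [← RR_map, Polynomial.derivative_map, resultant_map_map]
end

end SecondTangency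
namespace SecondTangency
open Polynomial

lemma hom_eval {A : Type*} [CommRing A] {F : MvPolynomial (Fin 3) A} {d : ℕ}
    (hF : F.IsHomogeneous d) (c : A) (v : Fin 3 → A) :
    MvPolynomial.eval (fun i => c * v i) F = c ^ d * MvPolynomial.eval v F := by
  rw [MvPolynomial.eval_eq, MvPolynomial.eval_eq, Finset.mul_sum]
  refine Finset.sum_congr rfl fun m hm => ?_
  have h := hF (MvPolynomial.mem_support_iff.mp hm)
  rw [Finsupp.weight_apply, Finsupp.sum_fintype _ _ (by simp)] at h
  simp only [Pi.one_apply, smul_eq_mul, mul_one] at h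
  have h2 : ∏ i ∈ m.support, (c * v i) ^ m i = ∏ i, (c * v i) ^ m i :=
    Finset.prod_subset (Finset.subset_univ _) (by intro i _ hi; simp at hi; simp [hi])
  have h3 : ∏ i ∈ m.support, (v i) ^ m i = ∏ i, (v i) ^ m i :=
    Finset.prod_subset (Finset.subset_univ _) (by intro i _ hi; simp at hi; simp [hi])
  rw [h2, h3, ← h]
  simp only [mul_pow, Finset.prod_mul_distrib, Finset.prod_pow_eq_pow_sum]
  ring

lemma lp_add {A : Type*} [CommRing A] (F G : MvPolynomial (Fin 3) A) (v w : Fin 3 → A) :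
    lp (F + G) v w = lp F v w + lp G v w := by simp [lp]

lemma lp_smul {A : Type*} [CommRing A] (a : A) (F : MvPolynomial (Fin 3) A) (v w : Fin 3 → A) :
    lp (a • F) v w = C a * lp F v w := by simp [lp, smul_eq_C_mul]

lemma lp_coeff_zero {A : Type*} [CommRing A] (F : MvPolynomial (Fin 3) A) (v w : Fin 3 → A) :
    (lp F v w).coeff 0 = MvPolynomial.eval v F := by
  rw [coeff_zero_eq_eval_zero, lp_eval]; simp

lemma lp_coeff_one {A : Type*} [CommRing A] (F : MvPolynomial (Fin 3) A) (v w : Fin 3 → A) :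
    (lp F v w).coeff 1 = ∑ i, MvPolynomial.eval v (MvPolynomial.pderiv i F) * w i := by
  induction F using MvPolynomial.induction_on with
  | C a => simp [lp, coeff_C]
  | add p q h1 h2 => simp only [lp_add, coeff_add, h1, h2, map_add, add_mul, Finset.sum_add_distrib]
  | mul_X p j h =>
    have h0 := lp_coeff_zero p v w
    have e : lp (p * MvPolynomial.X j) v w = lp p v w * C (v j) + lp p v w * C (w j) * X := by
      simp [lp]; ring
    rw [e, coeff_add, coeff_mul_C, coeff_mul_X, coeff_mul_C, h, h0]
    simp only [Derivation.leibniz, MvPolynomial.pderiv_X, map_add, smul_eq_mul, map_mul,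
      MvPolynomial.eval_X, Fin.sum_univ_three, Pi.single_apply]
    fin_cases j <;> simp <;> ring

variable {F G : MvPolynomial (Fin 3) ℂ} {d : ℕ}

lemma lp_refl (hF : F.IsHomogeneous d) (w v : Fin 3 → ℂ) :
    (lp F w v).natDegree ≤ d ∧ ∀ i ≤ d, (lp F w v).coeff i = (lp F v w).coeff (d - i) := by
  apply refl_lemma
  intro s hs
  rw [lp_eval, lp_eval, ← hom_eval hF]
  congr 1
  congr 1
  ext i; field_simp; ring

lemma lp_lead (hF : F.IsHomogeneous d) (hd : 3 ≤ d) (w v : Fin 3 → ℂ) :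
    (lp F w v).coeff (d - 1) = ∑ i, MvPolynomial.eval v (MvPolynomial.pderiv i F) * w i := by
  rw [(lp_refl hF w v).2 _ (by omega), ← lp_coeff_one]
  congr 1; omega

lemma lp_top (hF : F.IsHomogeneous d) (w v : Fin 3 → ℂ) :
    (lp F w v).coeff d = MvPolynomial.eval v F := by
  rw [(lp_refl hF w v).2 _ le_rfl, Nat.sub_self, lp_coeff_zero]

lemma euler (hF : F.IsHomogeneous d) (v : Fin 3 → ℂ) (hv : MvPolynomial.eval v F = 0) :
    ∑ i, MvPolynomial.eval v (MvPolynomial.pderiv i F) * v i = 0 := by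
  have h := congrArg (MvPolynomial.eval v) hF.sum_X_mul_pderiv
  simp only [map_sum, map_mul, MvPolynomial.eval_X, map_nsmul, hv, smul_zero] at h
  rw [← h]
  exact Finset.sum_congr rfl fun i _ => mul_comm _ _

lemma lp_shift (F : MvPolynomial (Fin 3) ℂ) (w v : Fin 3 → ℂ) (s : ℂ) :
    lp F (fun i => w i + s * v i) v = (lp F w v).comp (X + C s) := by
  apply Polynomial.funext
  intro r
  rw [lp_eval, eval_comp, lp_eval]
  congr 2
  ext i; simp; ring

lemma lp_scale (hF : F.IsHomogeneous d) (w v : Fin 3 → ℂ) (c : ℂ) (hc : c ≠ 0) :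
    lp F (fun i => c * w i) v = C (c ^ d) * (lp F w v).comp (C c⁻¹ * X) := by
  apply Polynomial.funext
  intro r
  rw [lp_eval, eval_mul, eval_comp, lp_eval, eval_C, ← hom_eval hF]
  congr 2
  ext i; simp; field_simp

lemma sq_dvd_comp_iff (p : ℂ[X]) (s : ℂ) :
    X ^ 2 ∣ p.comp (X + C s) ↔ p.eval s = 0 ∧ (derivative p).eval s = 0 := by
  rw [X_pow_dvd_iff]
  have h0 : (p.comp (X + C s)).coeff 0 = p.eval s := by
    rw [coeff_zero_eq_eval_zero]; simp
  have h1 : (p.comp (X + C s)).coeff 1 = (derivative p).eval s := by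
    have : (derivative (p.comp (X + C s))).coeff 0 = (derivative p).eval s := by
      rw [coeff_zero_eq_eval_zero, derivative_comp]; simp
    rw [← this, coeff_derivative]; simp
  constructor
  · intro h; exact ⟨h0 ▸ h 0 (by norm_num), h1 ▸ h 1 (by norm_num)⟩
  · rintro ⟨a, b⟩ i hi
    interval_cases i
    · rw [h0, a]
    · rw [h1, b]

/-! ### properties of `gg` -/

lemma gg_natDegree (hF : F.IsHomogeneous d) (hG : G.IsHomogeneous d) (hd : 3 ≤ d)
    (w v : Fin 3 → ℂ) (hFv : MvPolynomial.eval v F = 0) (hGv : MvPolynomial.eval v G = 0) :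
    (gg d F G w v).natDegree ≤ d - 2 := by
  rw [natDegree_le_iff_coeff_eq_zero]
  intro i hi
  simp only [gg, coeff_sub, coeff_C_mul]
  rcases lt_trichotomy i d with h | h | h
  · have : i = d - 1 := by omega
    subst this; ring
  · subst h
    rw [lp_top hF, lp_top hG, hFv, hGv]; ring
  · rw [coeff_eq_zero_of_natDegree_lt ((lp_refl hF w v).1.trans_lt h),
      coeff_eq_zero_of_natDegree_lt ((lp_refl hG w v).1.trans_lt h)]; ring

lemma gg_scale (hF : F.IsHomogeneous d) (hG : G.IsHomogeneous d) (hd : 3 ≤ d)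
    (w v : Fin 3 → ℂ) (c : ℂ) (hc : c ≠ 0) :
    gg d F G (fun i => c * w i) v = C (c ^ (d + 1)) * (gg d F G w v).comp (C c⁻¹ * X) := by
  have h1 : ∀ F : MvPolynomial (Fin 3) ℂ, F.IsHomogeneous d →
      (lp F (fun i => c * w i) v).coeff (d - 1) = c * (lp F w v).coeff (d - 1) := by
    intro F hF
    rw [lp_lead hF hd, lp_lead hF hd, Finset.mul_sum]
    exact Finset.sum_congr rfl fun i _ => by ring
  rw [gg, h1 F hF, h1 G hG, lp_scale hF w v c hc, lp_scale hG w v c hc]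
  simp only [gg, sub_comp, mul_comp, C_comp, C_mul, C_pow]
  ring

lemma D_gg_scale (hF : F.IsHomogeneous d) (hG : G.IsHomogeneous d) (hd : 3 ≤ d)
    (w v : Fin 3 → ℂ) (c : ℂ) (hc : c ≠ 0) :
    D (d - 2) (gg d F G (fun i => c * w i) v) =
      c ^ ((d - 3) * (d + 4)) * D (d - 2) (gg d F G w v) := by
  rw [gg_scale hF hG hd w v c hc, D_scale _ _ _ _ (inv_ne_zero hc)]
  congr 1
  obtain ⟨e, rfl⟩ : ∃ e, d = e + 3 := ⟨d - 3, by omega⟩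
  have e1 : e + 3 - 2 - 1 = e := by omega
  have e2 : e + 3 - 3 = e := by omega
  rw [e1, e2, ← pow_mul, inv_pow, ← div_eq_mul_inv, div_eq_iff (pow_ne_zero _ hc), ← pow_add]
  congr 1; ring

lemma gg_coeff_scale (hF : F.IsHomogeneous d) (hG : G.IsHomogeneous d) (hd : 3 ≤ d)
    (w v : Fin 3 → ℂ) (c : ℂ) (hc : c ≠ 0) (i : ℕ) (hi : i ≤ d + 1) :
    (gg d F G (fun i => c * w i) v).coeff i = c ^ (d + 1 - i) * (gg d F G w v).coeff i := by
  rw [gg_scale hF hG hd w v c hc, coeff_C_mul, comp_C_mul_X_coeff]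
  have : c ^ (d + 1) = c ^ (d + 1 - i) * c ^ i := by rw [← pow_add]; congr 1; omega
  rw [this, inv_pow]
  field_simp

end SecondTangency
namespace SecondTangency
open Polynomial

variable {F G : MvPolynomial (Fin 3) ℂ} {d : ℕ}

lemma gg_inv (hF : F.IsHomogeneous d) (hG : G.IsHomogeneous d) (hd : 3 ≤ d) (v : Fin 3 → ℂ)
    (x : ℂ) (hx : x ≠ 0) : (![1, x, 0] : Fin 3 → ℂ) = fun i => x * (![x⁻¹, 1, 0] : Fin 3 → ℂ) i := by
  ext i; fin_cases i <;> simp [hx]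

lemma gg_slope (w : Fin 3 → ℂ) (h0 : w 0 ≠ 0) (h2 : w 2 = 0) :
    w = fun i => w 0 * (![1, w 1 / w 0, 0] : Fin 3 → ℂ) i := by
  ext i; fin_cases i <;> simp [h2]; field_simp

lemma gg_slope' (w : Fin 3 → ℂ) (h0 : w 0 = 0) (h2 : w 2 = 0) :
    w = fun i => w 1 * (![0, 1, 0] : Fin 3 → ℂ) i := by
  ext i; fin_cases i <;> simp [h2, h0]

lemma RR_refl (hF : F.IsHomogeneous d) (hG : G.IsHomogeneous d) (hd : 3 ≤ d) (v : Fin 3 → ℂ) :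
    (RR d F G v).natDegree ≤ (d - 3) * (d + 4) ∧
      D3 d F G v = D (d - 2) (gg d F G ![0, 1, 0] v) := by
  have h := refl_lemma (RR d F G v) (D (d - 2) (gy d F G v)) ((d - 3) * (d + 4)) (by
    intro x hx
    rw [RR_eval, gg_inv hF hG hd v x hx, D_gg_scale hF hG hd _ _ _ hx, ← gy_eval, D_map]; rfl)
  refine ⟨h.1, ?_⟩
  rw [D3, h.2 _ le_rfl, Nat.sub_self, coeff_zero_eq_eval_zero, ← gy_eval, D_map]; rfl

lemma gx_coeff_refl (hF : F.IsHomogeneous d) (hG : G.IsHomogeneous d) (hd : 3 ≤ d) (v : Fin 3 → ℂ)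
    (i : ℕ) (hi : i ≤ d + 1) :
    ((gx d F G v).coeff i).natDegree ≤ d + 1 - i ∧
      ((gx d F G v).coeff i).coeff (d + 1 - i) = (gg d F G ![0, 1, 0] v).coeff i := by
  have h := refl_lemma ((gx d F G v).coeff i) ((gy d F G v).coeff i) (d + 1 - i) (by
    intro x hx
    have e1 : ((gx d F G v).coeff i).eval x = (gg d F G ![1, x, 0] v).coeff i := by
      rw [← gx_eval, coeff_map]; rfl
    rw [e1, gg_inv hF hG hd v x hx, gg_coeff_scale hF hG hd _ _ _ hx _ hi, ← gy_eval, coeff_map]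
    rfl)
  refine ⟨h.1, ?_⟩
  rw [h.2 _ le_rfl, Nat.sub_self, coeff_zero_eq_eval_zero, ← gy_eval, coeff_map]; rfl

lemma gg_nondeg (hF : F.IsHomogeneous d) (hG : G.IsHomogeneous d) (hd : 3 ≤ d) (v : Fin 3 → ℂ)
    (h2 : D2 d F G v ≠ 0) (w : Fin 3 → ℂ) (hw : w ≠ 0) (hw2 : w 2 = 0) :
    (gg d F G w v).coeff (d - 2) ≠ 0 ∨ (gg d F G w v).coeff (d - 2 - 1) ≠ 0 := by
  have hd3 : d - 2 - 1 = d - 3 := by omega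
  rw [hd3]
  by_contra hcon
  push Not at hcon
  obtain ⟨c1, c2⟩ := hcon
  have b1 := gx_coeff_refl hF hG hd v (d - 2) (by omega)
  have b2 := gx_coeff_refl hF hG hd v (d - 3) (by omega)
  have e1 : d + 1 - (d - 2) = 3 := by omega
  have e2 : d + 1 - (d - 3) = 4 := by omega
  rw [e1] at b1
  rw [e2] at b2
  apply h2
  by_cases h0 : w 0 = 0
  · have h1 : w 1 ≠ 0 := by
      intro h1; apply hw; ext i; fin_cases i <;> simp [h0, h1, hw2]
    rw [gg_slope' w h0 hw2, gg_coeff_scale hF hG hd _ _ _ h1 _ (by omega)] at c1 c2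
    simp only [mul_eq_zero, h1, pow_eq_zero_iff', false_and, false_or] at c1 c2
    exact resultant_zero_of_lead _ _ 3 4 b1.1 b2.1 (by norm_num) (by norm_num)
      (b1.2.trans c1) (b2.2.trans c2)
  · rw [gg_slope w h0 hw2, gg_coeff_scale hF hG hd _ _ _ h0 _ (by omega)] at c1 c2
    simp only [mul_eq_zero, h0, pow_eq_zero_iff', false_and, false_or] at c1 c2
    refine resultant_zero_of_root _ _ 3 4 (w 1 / w 0) b1.1 b2.1 (by norm_num) ?_ ?_
    · rw [← c1, ← gx_eval, coeff_map]; rfl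
    · rw [← c2, ← gx_eval, coeff_map]; rfl

lemma F1_lin (hF : F.IsHomogeneous d) (hd : 3 ≤ d) (v w : Fin 3 → ℂ) (hw2 : w 2 = 0) :
    (lp F w v).coeff (d - 1) = w 0 * (lp F ![1, 0, 0] v).coeff (d - 1) +
      w 1 * (lp F ![0, 1, 0] v).coeff (d - 1) := by
  simp only [lp_lead hF hd, Fin.sum_univ_three, hw2]
  simp; ring

lemma F1_ne (hF : F.IsHomogeneous d) (hG : G.IsHomogeneous d) (hd : 3 ≤ d) (v w : Fin 3 → ℂ)
    (h1 : D1 d F G v ≠ 0) (hw : w ≠ 0) (hw2 : w 2 = 0) (h : (lp F w v).coeff (d - 1) = 0) :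
    (lp G w v).coeff (d - 1) ≠ 0 := by
  intro h'
  rw [F1_lin hF hd v w hw2] at h
  rw [F1_lin hG hd v w hw2] at h'
  unfold D1 at h1
  set a := (lp F ![1, 0, 0] v).coeff (d - 1)
  set b := (lp F ![0, 1, 0] v).coeff (d - 1)
  set a' := (lp G ![1, 0, 0] v).coeff (d - 1)
  set b' := (lp G ![0, 1, 0] v).coeff (d - 1)
  apply hw
  have k0 : w 0 * (a * b' - b * a') = 0 := by linear_combination b' * h - b * h'
  have k1 : w 1 * (a * b' - b * a') = 0 := by linear_combination a * h' - a' * h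
  ext i; fin_cases i
  · simpa [h1] using k0
  · simpa [h1] using k1
  · simpa using hw2

/-- number of roots -/
lemma card_roots_of_sep (R : ℂ[X]) (M : ℕ) (hdeg : R.natDegree ≤ M) (hl : R.coeff M ≠ 0)
    (hr : resultant R (derivative R) M (M - 1) ≠ 0) :
    {x | R.eval x = 0}.Finite ∧ {x | R.eval x = 0}.ncard = M := by
  have hR : R ≠ 0 := by rintro rfl; simp at hl
  have hdeg' : R.natDegree = M := le_antisymm hdeg (le_natDegree_of_ne_zero hl)
  have hset : {x | R.eval x = 0} = (R.roots.toFinset : Set ℂ) := by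
    ext x; simp [hR]
  have hnd : R.roots.Nodup := by
    rw [Multiset.nodup_iff_count_le_one]
    intro x
    rw [count_roots]
    by_contra! hlt
    have hx := (one_lt_rootMultiplicity_iff_isRoot hR).mp hlt
    apply hr
    have hM : M ≠ 0 := by
      rintro rfl
      have : R = C (R.coeff 0) := eq_C_of_natDegree_eq_zero hdeg'
      rw [this] at hx
      exact hl (by simpa using hx.1)
    exact resultant_zero_of_root _ _ M (M - 1) x hdeg
      ((natDegree_derivative_le R).trans (by omega)) (Or.inl hM) hx.1 hx.2
  refine ⟨hset ▸ Finset.finite_toSet _, ?_⟩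
  rw [hset, Set.ncard_coe_finset, Multiset.toFinset_card_of_nodup hnd,
    IsAlgClosed.card_roots_eq_natDegree, hdeg']

end SecondTangency
namespace SecondTangency
open Polynomial

variable {F G : MvPolynomial (Fin 3) ℂ} {d : ℕ}

lemma vec_ne (x : ℂ) : (![1, x, 0] : Fin 3 → ℂ) ≠ 0 := by
  intro h; simpa using congrFun h 0

/-- a form with a double root along `w + s v` -/
lemma D_of_double (hF : F.IsHomogeneous d) (hG : G.IsHomogeneous d) (hd : 3 ≤ d) (v : Fin 3 → ℂ)
    (hFv : MvPolynomial.eval v F = 0) (hGv : MvPolynomial.eval v G = 0)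
    (h2 : D2 d F G v ≠ 0) (w : Fin 3 → ℂ) (hw : w ≠ 0) (hw2 : w 2 = 0) :
    D (d - 2) (gg d F G w v) = 0 ↔
      ∃ s, (gg d F G w v).eval s = 0 ∧ (derivative (gg d F G w v)).eval s = 0 :=
  D_eq_zero_iff _ (by omega) _ (gg_natDegree hF hG hd w v hFv hGv) (gg_nondeg hF hG hd v h2 w hw hw2)

lemma prop_of_zero (a b c0 c1 : ℂ) (hab : a = 0 → b ≠ 0) (h : c0 * a + c1 * b = 0)  :
    ∃ μ, c0 = μ * b ∧ c1 = -(μ * a) := by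
  by_cases ha : a = 0
  · have hb := hab ha
    subst ha
    simp [hb] at h
    exact ⟨c0 / b, by field_simp, by simp [h]⟩
  · refine ⟨-c1 / a, ?_, by field_simp⟩
    field_simp
    linear_combination h

lemma sum_pencil (F G : MvPolynomial (Fin 3) ℂ) (v u : Fin 3 → ℂ)
    (c : Projectivization ℂ (Fin 2 → ℂ)) :
    ∑ i, MvPolynomial.eval v (MvPolynomial.pderiv i (pencilMember F G c)) * u i =
      c.rep 0 * (∑ i, MvPolynomial.eval v (MvPolynomial.pderiv i F) * u i) +
      c.rep 1 * (∑ i, MvPolynomial.eval v (MvPolynomial.pderiv i G) * u i) := by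
  simp only [pencilMember, map_add, Derivation.map_smul, MvPolynomial.smul_eval,
    Fin.sum_univ_three]
  ring

lemma rep_eq_zero (c : Projectivization ℂ (Fin 2 → ℂ)) (h0 : c.rep 0 = 0) (h1 : c.rep 1 = 0) :
    False := by
  apply c.rep_nonzero
  ext i; fin_cases i
  · exact h0
  · exact h1

lemma mem_iff (hF : F.IsHomogeneous d) (hG : G.IsHomogeneous d) (hd : 3 ≤ d) (v : Fin 3 → ℂ)
    (hv2 : v 2 = 1)
    (hFv : MvPolynomial.eval v F = 0) (hGv : MvPolynomial.eval v G = 0)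
    (h1 : D1 d F G v ≠ 0) (h2 : D2 d F G v ≠ 0) (h3 : D3 d F G v ≠ 0)
    (c : Projectivization ℂ (Fin 2 → ℂ)) :
    c ∈ membersWithSecondTangency F G v ↔ ∃ x, (RR d F G v).eval x = 0 ∧
      c.rep 0 * (lp F ![1, x, 0] v).coeff (d - 1) +
      c.rep 1 * (lp G ![1, x, 0] v).coeff (d - 1) = 0 := by
  have hlpc : ∀ w, lp (pencilMember F G c) w v =
      C (c.rep 0) * lp F w v + C (c.rep 1) * lp G w v := by
    intro w; rw [pencilMember, lp_add, lp_smul, lp_smul]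
  constructor
  · rintro ⟨-, u, hu, hli, hc⟩
    set w : Fin 3 → ℂ := fun i => u i + (-u 2) * v i with hw
    have hw2 : w 2 = 0 := by simp [hw, hv2]
    have huw : u = fun i => w i + u 2 * v i := by ext i; simp [hw]
    have hw0 : w ≠ 0 := by
      intro h
      rw [LinearIndependent.pair_iff] at hli
      have := hli (-u 2) 1 (by
        ext i; have := congrFun h i; simp [hw] at this; simp; linear_combination this)
      simpa using this.2
    rw [sum_pencil] at hu
    have hE : ∀ F : MvPolynomial (Fin 3) ℂ, F.IsHomogeneous d → MvPolynomial.eval v F = 0 →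
        ∑ i, MvPolynomial.eval v (MvPolynomial.pderiv i F) * u i = (lp F w v).coeff (d - 1) := by
      intro F hF hFv
      rw [lp_lead hF hd]
      have := euler hF v hFv
      simp only [Fin.sum_univ_three, hw] at this ⊢
      linear_combination (u 2) * this
    rw [hE F hF hFv, hE G hG hGv] at hu
    obtain ⟨μ, hμ0, hμ1⟩ := prop_of_zero _ _ _ _ (F1_ne hF hG hd v w h1 hw0 hw2) hu
    have hμ : μ ≠ 0 := by
      rintro rfl
      exact rep_eq_zero c (by simpa using hμ0) (by simpa using hμ1)
    have hgg : lp (pencilMember F G c) w v = C μ * gg d F G w v := by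
      rw [hlpc, hμ0, hμ1, gg]; simp only [C_mul, C_neg]; ring
    change X ^ 2 ∣ lp (pencilMember F G c) u v at hc
    rw [huw, lp_shift, sq_dvd_comp_iff, hgg] at hc
    simp [hμ] at hc
    have hD := (D_of_double hF hG hd v hFv hGv h2 w hw0 hw2).mpr ⟨_, hc⟩
    have hw00 : w 0 ≠ 0 := by
      intro h0
      have h1 : w 1 ≠ 0 := by
        intro h1; apply hw0; ext i; fin_cases i <;> simp [h0, h1, hw2]
      rw [gg_slope' w h0 hw2, D_gg_scale hF hG hd _ _ _ h1, ← (RR_refl hF hG hd v).2] at hD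
      exact (mul_ne_zero (pow_ne_zero _ h1) h3) hD
    refine ⟨w 1 / w 0, ?_, ?_⟩
    · rw [gg_slope w hw00 hw2, D_gg_scale hF hG hd _ _ _ hw00, ← RR_eval] at hD
      exact (mul_eq_zero.mp hD).resolve_left (pow_ne_zero _ hw00)
    · rw [F1_lin hF hd v w hw2, F1_lin hG hd v w hw2] at hu
      rw [F1_lin hF hd v _ (by simp), F1_lin hG hd v _ (by simp)]
      simp
      field_simp
      linear_combination hu
  · rintro ⟨x, hx, hu⟩
    set w : Fin 3 → ℂ := ![1, x, 0] with hw
    have hw0 : w ≠ 0 := vec_ne x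
    have hw2 : w 2 = 0 := by simp [hw]
    rw [RR_eval, D_of_double hF hG hd v hFv hGv h2 w hw0 hw2] at hx
    obtain ⟨s, hs⟩ := hx
    obtain ⟨μ, hμ0, hμ1⟩ := prop_of_zero _ _ _ _ (F1_ne hF hG hd v w h1 hw0 hw2) hu
    have hgg : lp (pencilMember F G c) w v = C μ * gg d F G w v := by
      rw [hlpc, hμ0, hμ1, gg]; simp only [C_mul, C_neg]; ring
    refine ⟨?_, fun i => w i + s * v i, ?_, ?_, ?_⟩
    · by_contra hcon
      push Not at hcon
      have hz : ∀ u : Fin 3 → ℂ,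
          c.rep 0 * (lp F u v).coeff (d - 1) + c.rep 1 * (lp G u v).coeff (d - 1) = 0 := by
        intro u
        rw [lp_lead hF hd, lp_lead hG hd, ← sum_pencil]
        simp [hcon]
      have z0 := hz ![1, 0, 0]
      have z1 := hz ![0, 1, 0]
      unfold D1 at h1
      set a := (lp F ![1, 0, 0] v).coeff (d - 1)
      set b := (lp F ![0, 1, 0] v).coeff (d - 1)
      set a' := (lp G ![1, 0, 0] v).coeff (d - 1)
      set b' := (lp G ![0, 1, 0] v).coeff (d - 1)
      have k0 : c.rep 0 * (a * b' - b * a') = 0 := by linear_combination b' * z0 - a' * z1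
      have k1 : c.rep 1 * (a * b' - b * a') = 0 := by linear_combination a * z1 - b * z0
      exact rep_eq_zero c (by simpa [h1] using k0) (by simpa [h1] using k1)
    · rw [sum_pencil]
      rw [lp_lead hF hd, lp_lead hG hd] at hu
      have e1 := euler hF v hFv
      have e2 := euler hG v hGv
      simp only [Fin.sum_univ_three] at *
      linear_combination hu + c.rep 0 * s * e1 + c.rep 1 * s * e2
    · rw [LinearIndependent.pair_iff]
      intro a b hab
      have q0 := congrFun hab 0
      have q2 := congrFun hab 2
      have q1 := congrFun hab 1
      simp [hw, hv2] at q0 q1 q2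
      have hb : b = 0 := by linear_combination q0 - v 0 * q2
      subst hb
      simpa using q2
    · change X ^ 2 ∣ lp (pencilMember F G c) _ v
      rw [lp_shift, sq_dvd_comp_iff, hgg]
      simp [hs]

theorem count_main (hF : F.IsHomogeneous d) (hG : G.IsHomogeneous d) (hd : 3 ≤ d) (v : Fin 3 → ℂ)
    (hv2 : v 2 = 1)
    (hFv : MvPolynomial.eval v F = 0) (hGv : MvPolynomial.eval v G = 0)
    (h1 : D1 d F G v ≠ 0) (h2 : D2 d F G v ≠ 0) (h3 : D3 d F G v ≠ 0) (h4 : D4 d F G v ≠ 0) :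
    (membersWithSecondTangency F G v).Finite ∧
      (membersWithSecondTangency F G v).ncard = (d - 3) * (d + 4) := by
  obtain ⟨hfin, hcard⟩ := card_roots_of_sep (RR d F G v) _ (RR_refl hF hG hd v).1 h3 h4
  have hne : ∀ x : ℂ, (![(lp G ![1, x, 0] v).coeff (d - 1),
      -(lp F ![1, x, 0] v).coeff (d - 1)] : Fin 2 → ℂ) ≠ 0 := by
    intro x h
    refine F1_ne hF hG hd v ![1, x, 0] h1 (vec_ne x) (by simp) ?_ ?_
    · simpa using congrFun h 1
    · simpa using congrFun h 0
  set φ : ℂ → Projectivization ℂ (Fin 2 → ℂ) := fun x => Projectivization.mk ℂ _ (hne x) with hφ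
  have hset : membersWithSecondTangency F G v = φ '' {x | (RR d F G v).eval x = 0} := by
    ext c
    rw [mem_iff hF hG hd v hv2 hFv hGv h1 h2 h3]
    constructor
    · rintro ⟨x, hx, hc⟩
      refine ⟨x, hx, ?_⟩
      obtain ⟨μ, hμ0, hμ1⟩ := prop_of_zero _ _ _ _
        (F1_ne hF hG hd v _ h1 (vec_ne x) (by simp)) hc
      have hμ : μ ≠ 0 := by
        rintro rfl
        exact rep_eq_zero c (by simpa using hμ0) (by simpa using hμ1)
      rw [hφ, ← c.mk_rep]
      simp only
      rw [Projectivization.mk_eq_mk_iff']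
      refine ⟨μ⁻¹, ?_⟩
      ext i; fin_cases i
      · simp [hμ0]; field_simp
      · simp [hμ1]; field_simp
    · rintro ⟨x, hx, rfl⟩
      refine ⟨x, hx, ?_⟩
      obtain ⟨a, ha⟩ := Projectivization.exists_smul_eq_mk_rep ℂ _ (hne x)
      rw [hφ]
      simp only
      rw [← ha]
      simp [Units.smul_def]; ring
  have hinj : Function.Injective φ := by
    intro x y hxy
    rw [hφ] at hxy
    simp only at hxy
    rw [Projectivization.mk_eq_mk_iff'] at hxy
    obtain ⟨a, ha⟩ := hxy
    have q0 := congrFun ha 0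
    have q1 := congrFun ha 1
    simp at q0 q1
    rw [F1_lin hG hd v _ (by simp), F1_lin hG hd v ![1, x, 0] (by simp)] at q0
    rw [F1_lin hF hd v _ (by simp), F1_lin hF hd v ![1, x, 0] (by simp)] at q1
    simp at q0 q1
    unfold D1 at h1
    set p := (lp F ![1, 0, 0] v).coeff (d - 1)
    set q := (lp F ![0, 1, 0] v).coeff (d - 1)
    set p' := (lp G ![1, 0, 0] v).coeff (d - 1)
    set q' := (lp G ![0, 1, 0] v).coeff (d - 1)
    have k0 : (a - 1) * (p * q' - q * p') = 0 := by linear_combination q' * q1 - q * q0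
    have k1 : (a * y - x) * (p * q' - q * p') = 0 := by linear_combination p * q0 - p' * q1
    have a1 : a = 1 := by
      have := (mul_eq_zero.mp k0).resolve_right h1
      linear_combination this
    have := (mul_eq_zero.mp k1).resolve_right h1
    rw [a1] at this
    linear_combination -this
  rw [hset]
  exact ⟨hfin.image _, by rw [Set.ncard_image_of_injective _ hinj, hcard]⟩

lemma members_scale (hF : F.IsHomogeneous d) (hG : G.IsHomogeneous d) (hd : 3 ≤ d)
    (v : Fin 3 → ℂ) (c : ℂ) (hc : c ≠ 0) :
    membersWithSecondTangency F G (fun i => c * v i) = membersWithSecondTangency F G v := by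
  ext p
  have hH : (pencilMember F G p).IsHomogeneous d := by
    unfold pencilMember
    rw [MvPolynomial.smul_eq_C_mul, MvPolynomial.smul_eq_C_mul]
    exact (hF.C_mul _).add (hG.C_mul _)
  have hp : ∀ i, MvPolynomial.eval (fun i => c * v i)
      (MvPolynomial.pderiv i (pencilMember F G p)) = c ^ (d - 1) *
      MvPolynomial.eval v (MvPolynomial.pderiv i (pencilMember F G p)) := fun i =>
    hom_eval hH.pderiv c v
  have hc' : c ^ (d - 1) ≠ 0 := pow_ne_zero _ hc
  simp only [membersWithSecondTangency, Set.mem_ofPred_eq, hp]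
  refine and_congr ?_ (exists_congr fun u => and_congr ?_ (and_congr ?_ ?_))
  · simp [hc']
  · simp only [mul_assoc, ← Finset.mul_sum, mul_eq_zero, hc', false_or]
  · rw [LinearIndependent.pair_iff, LinearIndependent.pair_iff]
    constructor
    · intro h a b hab
      have := h (a / c) b (by
        rw [← hab]; ext i; simp; field_simp)
      simpa [hc] using this
    · intro h a b hab
      have := h (a * c) b (by
        rw [← hab]; ext i; simp; ring)
      simpa [hc] using this
  · change X ^ 2 ∣ lp _ _ _ ↔ X ^ 2 ∣ lp _ _ _
    have hl : lp (pencilMember F G p) u (fun i => c * v i) =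
        (lp (pencilMember F G p) u v).comp (C c * X) := by
      apply Polynomial.funext
      intro r
      rw [lp_eval, eval_comp, lp_eval]
      congr 2
      ext i; simp; ring
    rw [hl, X_pow_dvd_iff, X_pow_dvd_iff]
    simp [comp_C_mul_X_coeff, hc]

end SecondTangency
namespace SecondTangency
open Polynomial

lemma eval_C_swap (R : ℂ[X][X]) (x : ℂ) :
    R.eval (C x) = (Bivariate.swap R).map (evalRingHom x) := by
  have := Bivariate.aveal_eq_map_swap x R
  simpa [coe_aeval_eq_eval, aeval_def] using this

/-- a repeated factor comes from a repeated factor with polynomial coefficients -/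
lemma exists_sq_dvd (R : ℂ[X][X]) (M : ℕ) (hM : 0 < M) (hdeg : R.natDegree ≤ M)
    (hl : R.coeff M ≠ 0) (hr : resultant R (derivative R) M (M - 1) = 0) :
    ∃ h : ℂ[X][X], 0 < h.natDegree ∧ h * h ∣ R := by
  set K := FractionRing ℂ[X]
  have hinj : Function.Injective (algebraMap ℂ[X] K) := IsFractionRing.injective _ _
  have hR : R ≠ 0 := by rintro rfl; simp at hl
  have hdegR : R.natDegree = M := le_antisymm hdeg (le_natDegree_of_ne_zero hl)
  set RK := R.map (algebraMap ℂ[X] K) with hRK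
  have hdK : RK.natDegree = M := by rw [hRK, natDegree_map_eq_of_injective hinj, hdegR]
  have hdK' : (derivative RK).natDegree = M - 1 := by
    rw [natDegree_derivative, hdK]
  have hRK0 : RK ≠ 0 := (Polynomial.map_ne_zero_iff hinj).mpr hR
  have h0 : resultant RK (derivative RK) = 0 := by
    rw [hdK, hdK', hRK, derivative_map]
    rw [resultant_map_map, hr, map_zero]
  rw [resultant_eq_zero_iff] at h0
  have hns : ¬ Squarefree RK := by
    rw [← PerfectField.separable_iff_squarefree]; exact h0.2
  rw [squarefree_iff_irreducible_sq_not_dvd_of_ne_zero hRK0] at hns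
  push Not at hns
  obtain ⟨p, hp, hpd⟩ := hns
  classical
  let _ : NormalizedGCDMonoid ℂ[X] := Classical.choice inferInstance
  obtain ⟨b, hb, hbq⟩ := IsLocalization.integerNormalization_spec (nonZeroDivisors ℂ[X]) p
  set q := IsLocalization.integerNormalization (nonZeroDivisors ℂ[X]) p with hq
  have hb0 : algebraMap ℂ[X] K b ≠ 0 := by
    rw [Ne, map_eq_zero_iff _ hinj]; exact nonZeroDivisors.ne_zero hb
  have hbq' : q.map (algebraMap ℂ[X] K) = C (algebraMap ℂ[X] K b) * p := by
    rw [hbq, ← smul_eq_C_mul, algebraMap_smul]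
  have hu : IsUnit (C (algebraMap ℂ[X] K b)) := isUnit_C.mpr hb0.isUnit
  refine ⟨q.primPart, ?_, ?_⟩
  · rw [natDegree_primPart, ← natDegree_map_eq_of_injective hinj, hbq', natDegree_C_mul hb0]
    exact hp.natDegree_pos
  · apply (q.isPrimitive_primPart.mul q.isPrimitive_primPart).dvd_of_fraction_map_dvd_fraction_map
      (K := K)
    rw [Polynomial.map_mul]
    have h1 : q.primPart.map (algebraMap ℂ[X] K) ∣ p := by
      rw [← hu.dvd_mul_left, ← hbq']
      exact Polynomial.map_dvd _ q.primPart_dvd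
    exact (mul_dvd_mul h1 h1).trans hpd

lemma resultant_ne_of (R : ℂ[X][X]) (M m : ℕ) (hM : 0 < M) (hdeg : R.natDegree ≤ M)
    (hl : R.coeff M ≠ 0) (hsw : (Bivariate.swap R).natDegree ≤ m) (S : Finset ℂ)
    (hS : S.card = m) (hroot : ∀ c ∈ S, (R.eval (C 1)).eval c = 0)
    (hev : ∀ x : ℂ, R.eval (C x) ≠ 0) :
    resultant R (derivative R) M (M - 1) ≠ 0 := by
  intro hr
  obtain ⟨h, hh, q, hq⟩ := exists_sq_dvd R M hM hdeg hl hr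
  have hR : R ≠ 0 := by rintro rfl; simp at hl
  set r := R.eval (C 1) with hrdef
  have hr0 : r ≠ 0 := hev 1
  have hrdeg : r.natDegree ≤ m := by
    rw [hrdef, eval_C_swap]; exact natDegree_map_le.trans hsw
  have hsub : S ⊆ r.roots.toFinset := by
    intro c hc; simp [hr0, hroot c hc]
  have c1 := Finset.card_le_card hsub
  have c2 := Multiset.toFinset_card_le r.roots
  have c3 := r.card_roots'
  have hnd : r.roots.Nodup := by
    rw [← Multiset.toFinset_card_eq_card_iff_nodup]; omega
  have hsq : Squarefree r :=
    ((nodup_roots_iff_of_splits hr0 (IsAlgClosed.splits r)).mp hnd).squarefree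
  have hrq : r = h.eval (C 1) * h.eval (C 1) * q.eval (C 1) := by
    rw [hrdef, hq, eval_mul, eval_mul]
  have hu : IsUnit (h.eval (C 1)) := hsq _ ⟨_, hrq⟩
  have hh1 : (h.eval (C 1)).natDegree = 0 := natDegree_eq_zero_of_isUnit hu
  have hq1 : q.eval (C 1) ≠ 0 := by
    intro h0; rw [h0, mul_zero] at hrq; exact hr0 hrq
  have d1 : r.natDegree = (q.eval (C 1)).natDegree := by
    rw [hrq, natDegree_mul (mul_ne_zero hu.ne_zero hu.ne_zero) hq1,
      natDegree_mul hu.ne_zero hu.ne_zero, hh1]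
    simp
  have d2 : (q.eval (C 1)).natDegree ≤ (Bivariate.swap q).natDegree := by
    rw [eval_C_swap]; exact natDegree_map_le
  have hh0 : h ≠ 0 := by rintro rfl; simp at hh
  have hq0 : q ≠ 0 := by rintro rfl; simp at hq1
  have sh : Bivariate.swap h ≠ 0 := by simpa using hh0
  have sq : Bivariate.swap q ≠ 0 := by simpa using hq0
  have d3 : (Bivariate.swap R).natDegree = (Bivariate.swap h).natDegree +
      (Bivariate.swap h).natDegree + (Bivariate.swap q).natDegree := by
    rw [hq, map_mul, map_mul, natDegree_mul (mul_ne_zero sh sh) sq, natDegree_mul sh sh]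
  have d4 : (Bivariate.swap h).natDegree = 0 := by omega
  obtain ⟨k, hk⟩ := natDegree_eq_zero.mp d4
  have hhk : h = k.map C := by
    rw [← Bivariate.swap_C, hk, Bivariate.swap_swap_apply]
  have hkd : k.degree ≠ 0 := by
    intro h0
    rw [hhk, natDegree_map_eq_of_injective C_injective, natDegree_eq_of_degree_eq_some h0] at hh
    exact absurd hh (lt_irrefl 0)
  obtain ⟨x, hx⟩ := IsAlgClosed.exists_root k hkd
  apply hev x
  rw [hq, eval_mul, eval_mul, hhk, eval_map, eval₂_at_apply, hx.eq_zero]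
  simp

end SecondTangency
namespace SecondTangency
open Polynomial

section ex
variable (A : Type*) [CommRing A]

/-- first example -/
def exF (e : ℕ) : MvPolynomial (Fin 3) A :=
  -(MvPolynomial.X 0 * MvPolynomial.X 2 ^ (e + 2)) + MvPolynomial.X 1 ^ 2 * MvPolynomial.X 2 ^ (e + 1)
def exG (e : ℕ) : MvPolynomial (Fin 3) A :=
  MvPolynomial.X 1 * MvPolynomial.X 2 ^ (e + 2) + MvPolynomial.X 0 ^ 3 * MvPolynomial.X 2 ^ e

/-- second example -/
def fxF (e : ℕ) : MvPolynomial (Fin 3) A :=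
  -(MvPolynomial.X 0 * MvPolynomial.X 2 ^ (e + 3)) + MvPolynomial.X 1 ^ 2 * MvPolynomial.X 2 ^ (e + 2)
    + MvPolynomial.X 1 ^ (e + 4)
end ex

variable {A : Type*} [CommRing A]

def fxG (e : ℕ) (c : A) : MvPolynomial (Fin 3) A :=
  MvPolynomial.X 1 * MvPolynomial.X 2 ^ (e + 3)
    + (MvPolynomial.X 0 ^ 3 - MvPolynomial.X 0 ^ 2 * MvPolynomial.X 1) * MvPolynomial.X 2 ^ (e + 1)
    - MvPolynomial.C ((e : A) + 2) * (MvPolynomial.X 0 ^ (e + 2) * MvPolynomial.X 1 * MvPolynomial.X 2)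
    + MvPolynomial.C c * MvPolynomial.X 0 ^ (e + 4)

lemma hom_mon (a b c : ℕ) : (MvPolynomial.X 0 ^ a * MvPolynomial.X 1 ^ b * MvPolynomial.X 2 ^ c :
    MvPolynomial (Fin 3) A).IsHomogeneous (a + b + c) :=
  ((MvPolynomial.isHomogeneous_X_pow _ _).mul (MvPolynomial.isHomogeneous_X_pow _ _)).mul
    (MvPolynomial.isHomogeneous_X_pow _ _)

lemma hom_mon' (a b c d : ℕ) (h : a + b + c = d) (p : MvPolynomial (Fin 3) A)
    (hp : p = MvPolynomial.X 0 ^ a * MvPolynomial.X 1 ^ b * MvPolynomial.X 2 ^ c) :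
    p.IsHomogeneous d := by
  subst hp; subst h; exact hom_mon a b c

lemma exF_hom (e : ℕ) : (exF A e).IsHomogeneous (e + 3) :=
  (hom_mon' 1 0 (e + 2) _ (by ring) _ (by ring)).neg.add (hom_mon' 0 2 (e + 1) _ (by ring) _ (by ring))
lemma exG_hom (e : ℕ) : (exG A e).IsHomogeneous (e + 3) :=
  (hom_mon' 0 1 (e + 2) _ (by ring) _ (by ring)).add (hom_mon' 3 0 e _ (by ring) _ (by ring))
lemma fxF_hom (e : ℕ) : (fxF A e).IsHomogeneous (e + 4) :=
  ((hom_mon' 1 0 (e + 3) _ (by ring) _ (by ring)).neg.add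
    (hom_mon' 0 2 (e + 2) _ (by ring) _ (by ring))).add (hom_mon' 0 (e + 4) 0 _ (by ring) _ (by ring))
lemma fxG_hom (e : ℕ) (c : A) : (fxG e c).IsHomogeneous (e + 4) := by
  unfold fxG
  rw [sub_mul]
  exact (((hom_mon' 0 1 (e + 3) _ (by ring) _ (by ring)).add
    ((hom_mon' 3 0 (e + 1) _ (by ring) _ (by ring)).sub
      (hom_mon' 2 1 (e + 1) _ (by ring) _ (by ring)))).sub
    ((hom_mon' (e + 2) 1 1 _ (by ring) _ (by ring)).C_mul _)).add
    ((hom_mon' (e + 4) 0 0 _ (by ring) _ (by ring)).C_mul _)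

/-- the base point -/
def v0 (A : Type*) [CommRing A] : Fin 3 → A := ![0, 0, 1]

lemma v0_map {B : Type*} [CommRing B] (f : A →+* B) : f ∘ v0 A = v0 B := by
  ext i; fin_cases i <;> simp [v0]

lemma ex_eval0 (e : ℕ) : MvPolynomial.eval (v0 A) (exF A e) = 0 ∧
    MvPolynomial.eval (v0 A) (exG A e) = 0 := by simp [exF, exG, v0]
lemma fx_eval0 (e : ℕ) (c : A) : MvPolynomial.eval (v0 A) (fxF A e) = 0 ∧
    MvPolynomial.eval (v0 A) (fxG e c) = 0 := by simp [fxF, fxG, v0]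

section maps
variable {B : Type*} [CommRing B] (f : A →+* B) (e : ℕ)
lemma exF_map : MvPolynomial.map f (exF A e) = exF B e := by simp [exF]
lemma exG_map : MvPolynomial.map f (exG A e) = exG B e := by simp [exG]
lemma fxF_map : MvPolynomial.map f (fxF A e) = fxF B e := by simp [fxF]
lemma fxG_map (c : A) : MvPolynomial.map f (fxG e c) = fxG e (f c) := by
  have h2 : f 2 = 2 := map_ofNat f 2
  simp [fxG, h2]
end maps

lemma lp_exF (e : ℕ) (a b : A) : lp (exF A e) ![a, b, 0] (v0 A) =
    -(C a * X ^ (e + 2)) + C (b ^ 2) * X ^ (e + 1) := by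
  simp [lp, exF, v0]
lemma lp_exG (e : ℕ) (a b : A) : lp (exG A e) ![a, b, 0] (v0 A) =
    C b * X ^ (e + 2) + C (a ^ 3) * X ^ e := by
  simp [lp, exG, v0]
lemma lp_fxF (e : ℕ) (a b : A) : lp (fxF A e) ![a, b, 0] (v0 A) =
    -(C a * X ^ (e + 3)) + C (b ^ 2) * X ^ (e + 2) + C (b ^ (e + 4)) := by
  simp [lp, fxF, v0]
lemma lp_fxG (e : ℕ) (a b c : A) : lp (fxG e c) ![a, b, 0] (v0 A) =
    C b * X ^ (e + 3) + C (a ^ 3 - a ^ 2 * b) * X ^ (e + 1) - C ((e + 2) * (a ^ (e + 2) * b)) * X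
      + C (c * a ^ (e + 4)) := by
  simp [lp, fxG, v0, mul_assoc]

lemma co_exF (e : ℕ) (a b : A) : (lp (exF A e) ![a, b, 0] (v0 A)).coeff (e + 2) = -a := by
  rw [lp_exF]; simp [coeff_X_pow, -map_pow]
lemma co_exG (e : ℕ) (a b : A) : (lp (exG A e) ![a, b, 0] (v0 A)).coeff (e + 2) = b := by
  rw [lp_exG]; simp [coeff_X_pow, -map_pow]
lemma co_fxF (e : ℕ) (a b : A) : (lp (fxF A e) ![a, b, 0] (v0 A)).coeff (e + 3) = -a := by
  rw [lp_fxF]; simp [coeff_X_pow, coeff_C, -map_pow]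
lemma co_fxG (e : ℕ) (a b c : A) : (lp (fxG e c) ![a, b, 0] (v0 A)).coeff (e + 3) = b := by
  rw [lp_fxG]
  simp only [coeff_add, coeff_sub, coeff_C_mul, coeff_X_pow, coeff_C, coeff_X]
  simp

lemma gg_ex (e : ℕ) (a b : A) : gg (e + 3) (exF A e) (exG A e) ![a, b, 0] (v0 A) =
    C (b ^ 3) * X ^ (e + 1) + C (a ^ 4) * X ^ e := by
  have h : e + 3 - 1 = e + 2 := by omega
  rw [gg, h, co_exF, co_exG, lp_exF, lp_exG]
  simp only [C_mul, C_pow, C_neg]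
  ring

lemma gg_fx (e : ℕ) (a b c : A) : gg (e + 4) (fxF A e) (fxG e c) ![a, b, 0] (v0 A) =
    C (b ^ 3) * X ^ (e + 2) + C (a ^ 3 * (a - b)) * X ^ (e + 1)
      - C ((e + 2) * (a ^ (e + 3) * b)) * X + C (b ^ (e + 5)) + C (c * a ^ (e + 5)) := by
  have h : e + 4 - 1 = e + 3 := by omega
  rw [gg, h, co_fxF, co_fxG, lp_fxF, lp_fxG]
  simp only [C_mul, C_pow, C_neg, C_sub, C_add]
  ring

lemma D1_ex (e : ℕ) : D1 (e + 3) (exF ℂ e) (exG ℂ e) (v0 ℂ) ≠ 0 := by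
  have h : e + 3 - 1 = e + 2 := by omega
  rw [D1, h, co_exF, co_exG, co_exF, co_exG]
  norm_num

lemma D2_ex (e : ℕ) : D2 (e + 3) (exF ℂ e) (exG ℂ e) (v0 ℂ) ≠ 0 := by
  have h : gx (e + 3) (exF ℂ e) (exG ℂ e) (v0 ℂ) = C (X ^ 3) * X ^ (e + 1) + C 1 * X ^ e := by
    rw [gx, exF_map, exG_map, v0_map, gg_ex]; simp
  have e1 : e + 3 - 2 = e + 1 := by omega
  have e2 : e + 3 - 3 = e := by omega
  rw [D2, h, e1, e2]
  have k1 : ((C (X ^ 3) * X ^ (e + 1) + C 1 * X ^ e : ℂ[X][X])).coeff (e + 1) = X ^ 3 := by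
    simp only [coeff_add, coeff_C_mul, coeff_X_pow]; simp
  have k2 : ((C (X ^ 3) * X ^ (e + 1) + C 1 * X ^ e : ℂ[X][X])).coeff e = 1 := by
    simp only [coeff_add, coeff_C_mul, coeff_X_pow]; simp
  rw [k1, k2, resultant_one_right]
  simp

end SecondTangency
namespace SecondTangency
open Polynomial

lemma D_add_C (n : ℕ) (hn : 2 ≤ n) (p : ℂ[X]) (hp : p.natDegree ≤ n)
    (h : p.coeff n ≠ 0 ∨ p.coeff (n - 1) ≠ 0) : ∃ c : ℂ, D n (p + C c) ≠ 0 := by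
  have hd : derivative p ≠ 0 := by
    intro h0
    have hc : ∀ k, k ≠ 0 → p.coeff k = 0 := by
      intro k hk
      have := congrArg (fun q => q.coeff (k - 1)) h0
      simp only [coeff_derivative, coeff_zero] at this
      obtain ⟨j, rfl⟩ := Nat.exists_eq_succ_of_ne_zero hk
      simp only [Nat.succ_eq_add_one, Nat.add_sub_cancel] at this
      exact (mul_eq_zero.mp this).resolve_right (by exact_mod_cast Nat.succ_ne_zero j)
    rcases h with h | h
    · exact h (hc n (by omega))
    · exact h (hc (n - 1) (by omega))
  set S : Finset ℂ := (derivative p).roots.toFinset.image (fun s => -p.eval s)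
  obtain ⟨c, hc⟩ := Infinite.exists_notMem_finset S
  refine ⟨c, fun hD => hc ?_⟩
  have hco : ∀ k, k ≠ 0 → (p + C c).coeff k = p.coeff k := by
    intro k hk; rw [coeff_add, coeff_C_of_ne_zero hk, add_zero]
  rw [D_eq_zero_iff n (by omega) _ (by
    rw [natDegree_add_C]; exact hp) (by
      rw [hco n (by omega), hco (n - 1) (by omega)]; exact h)] at hD
  obtain ⟨s, h1, h2⟩ := hD
  simp at h1 h2
  refine Finset.mem_image.mpr ⟨s, by simp [hd, h2], ?_⟩
  linear_combination -h1

/-- the specialised polynomial -/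
def pfx (e : ℕ) (x : ℂ) : ℂ[X] :=
  C (x ^ 3) * X ^ (e + 2) + C (1 - x) * X ^ (e + 1) - C ((e + 2) * x) * X + C (x ^ (e + 5))

lemma gg_pfx (e : ℕ) (x c : ℂ) :
    gg (e + 4) (fxF ℂ e) (fxG e c) ![1, x, 0] (v0 ℂ) = pfx e x + C c := by
  rw [gg_fx, pfx]; simp

lemma pfx_natDegree (e : ℕ) (x : ℂ) : (pfx e x).natDegree ≤ e + 2 := by
  rw [pfx]
  have h1 : (C (x ^ 3) * X ^ (e + 2)).natDegree ≤ e + 2 := natDegree_C_mul_X_pow_le _ _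
  have h2 : (C (1 - x) * X ^ (e + 1)).natDegree ≤ e + 2 :=
    (natDegree_C_mul_X_pow_le _ _).trans (by omega)
  have h3 : (C ((e + 2) * x) * X).natDegree ≤ e + 2 := by
    have h := natDegree_C_mul_X_pow_le (((e : ℂ) + 2) * x) 1
    rw [pow_one] at h; omega
  have h4 : (C (x ^ (e + 5))).natDegree ≤ e + 2 := by rw [natDegree_C]; omega
  exact natDegree_add_le_of_degree_le (natDegree_sub_le_of_le (natDegree_add_le_of_degree_le h1 h2) h3
    |>.trans (by simp)) h4

lemma pfx_coeff (e : ℕ) (x : ℂ) : (pfx e x).coeff (e + 2) ≠ 0 ∨ (pfx e x).coeff (e + 2 - 1) ≠ 0 := by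
  by_cases hx : x = 0
  · right
    subst hx
    have : e + 2 - 1 = e + 1 := by omega
    rw [this, pfx]
    simp only [coeff_add, coeff_sub, coeff_C_mul, coeff_X_pow, coeff_C, coeff_X]
    simp
  · left
    rw [pfx]
    simp only [coeff_add, coeff_sub, coeff_C_mul, coeff_X_pow, coeff_C, coeff_X]
    simp [hx]

lemma D3_fx (e : ℕ) (c : ℂ) : D3 (e + 4) (fxF ℂ e) (fxG e c) (v0 ℂ) ≠ 0 := by
  have h4 : e + 4 - 2 = e + 2 := by omega
  rw [(RR_refl (fxF_hom e) (fxG_hom e c) (by omega) (v0 ℂ)).2, gg_fx, h4]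
  have h : (C ((1 : ℂ) ^ 3) * X ^ (e + 2) + C ((0 : ℂ) ^ 3 * (0 - 1)) * X ^ (e + 1) -
      C (((e : ℂ) + 2) * (0 ^ (e + 3) * 1)) * X + C (1 ^ (e + 5)) + C (c * 0 ^ (e + 5))) =
      X ^ (e + 2) + C 1 := by simp
  rw [h, Ne, D_eq_zero_iff (e + 2) (by omega) _ (by rw [natDegree_X_pow_add_C])
    (by left; simp [coeff_one])]
  rintro ⟨s, h1, h2⟩
  have h3 : (((e + 2 : ℕ) : ℂ)) ≠ 0 := by exact_mod_cast (by omega : e + 2 ≠ 0)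
  simp only [derivative_add, derivative_X_pow, derivative_C, add_zero, eval_mul, eval_C, eval_pow,
    eval_X, mul_eq_zero, h3, false_or, eval_add] at h1 h2
  have hs : s = 0 := pow_eq_zero_iff (by omega) |>.mp h2
  subst hs
  simp at h1

lemma RR_fx_eval (e : ℕ) (x c : ℂ) :
    ((RR (e + 4) (fxF ℂ[X] e) (fxG e X) (v0 ℂ[X])).eval (C x)).eval c =
      D (e + 2) (pfx e x + C c) := by
  have h : (RR (e + 4) (fxF ℂ[X] e) (fxG e X) (v0 ℂ[X])).map (evalRingHom c) =
      RR (e + 4) (fxF ℂ e) (fxG e c) (v0 ℂ) := by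
    rw [RR_map, fxF_map, fxG_map, v0_map]; simp
  have h2 := RR_eval (e + 4) (fxF ℂ e) (fxG e c) (v0 ℂ) x
  have h4 : e + 4 - 2 = e + 2 := by omega
  rw [gg_pfx, h4] at h2
  rw [← h2, ← h]
  have := eval_map_apply (p := RR (e + 4) (fxF ℂ[X] e) (fxG e X) (v0 ℂ[X])) (f := evalRingHom c) (C x)
  simpa using this.symm

lemma RR_fx_natDegree (e : ℕ) : (RR (e + 4) (fxF ℂ[X] e) (fxG e X) (v0 ℂ[X])).natDegree ≤
    (e + 4 - 3) * (e + 4 + 4) := by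
  rw [natDegree_le_iff_coeff_eq_zero]
  intro i hi
  apply Polynomial.funext
  intro c
  have h : (RR (e + 4) (fxF ℂ[X] e) (fxG e X) (v0 ℂ[X])).map (evalRingHom c) =
      RR (e + 4) (fxF ℂ e) (fxG e c) (v0 ℂ) := by
    rw [RR_map, fxF_map, fxG_map, v0_map]; simp
  have h2 := congrArg (fun p => p.coeff i) h
  simp only [coeff_map, coe_evalRingHom] at h2
  rw [h2, eval_zero]
  exact coeff_eq_zero_of_natDegree_lt
    ((RR_refl (fxF_hom e) (fxG_hom e c) (by omega) (v0 ℂ)).1.trans_lt hi)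

lemma D3_fx' (e : ℕ) : D3 (e + 4) (fxF ℂ[X] e) (fxG e X) (v0 ℂ[X]) ≠ 0 := by
  intro h
  have h2 := D3_map (evalRingHom 0) (e + 4) (fxF ℂ[X] e) (fxG e X) (v0 ℂ[X])
  rw [h, map_zero, fxF_map, fxG_map, v0_map] at h2
  exact D3_fx e _ h2.symm

lemma resultant_natDegree_le {A : Type*} [CommRing A] (f g : A[X][X]) (m : ℕ)
    (hf : ∀ i, (f.coeff i).natDegree ≤ 0) (hg : ∀ i, (g.coeff i).natDegree ≤ 1) :
    (resultant f g m m).natDegree ≤ m := by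
  refine (natDegree_det_le (sylvester f g m m)
    (fun j => Fin.addCases (fun _ => 1) (fun _ => 0) j) ?_).trans ?_
  · intro i j
    induction j using Fin.addCases with
    | left j =>
      simp only [sylvester, Matrix.of_apply, Fin.addCases_left]
      split_ifs
      · exact hg _
      · simp
    | right j =>
      simp only [sylvester, Matrix.of_apply, Fin.addCases_right]
      split_ifs
      · exact hf _
      · simp
  · rw [Fin.sum_univ_add]; simp only [Fin.addCases_left, Fin.addCases_right]; simp

lemma RR_fx_swap (e : ℕ) :
    (Bivariate.swap (RR (e + 4) (fxF ℂ[X] e) (fxG e X) (v0 ℂ[X]))).natDegree ≤ e + 1 := by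
  have h4 : e + 4 - 2 = e + 2 := by omega
  have h5 : e + 2 - 1 = e + 1 := by omega
  set σ : ℂ[X][X] →+* ℂ[X][X] := (Bivariate.swap (R := ℂ)).toRingEquiv.toRingHom with hσ
  have hσa : ∀ p, Bivariate.swap p = σ p := fun p => rfl
  have hX : σ X = C X := Bivariate.swap_Y
  have hCX : σ (C X) = X := Bivariate.swap_X
  set q : ℂ[X][X] := C (X ^ 3) * X ^ (e + 2) + C (1 - X) * X ^ (e + 1) - C ((e + 2) * X) * X
    + C (X ^ (e + 5)) with hq
  have hg : (gx (e + 4) (fxF ℂ[X] e) (fxG e X) (v0 ℂ[X])).map σ = q.map C + C X := by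
    rw [gx, fxF_map, fxG_map, v0_map, gg_fx, hq]
    have h2 : σ 2 = 2 := map_ofNat σ 2
    have h3 : (C (2 : ℂ[X]) : ℂ[X][X]) = 2 := map_ofNat C 2
    have h6 : (C (2 : ℂ[X][X]) : ℂ[X][X][X]) = 2 := map_ofNat C 2
    simp [hX, hCX, h2, h3, h6]
  rw [hσa, RR, ← D_map, hg, h4, D, h5]
  apply resultant_natDegree_le
  · intro i
    rw [derivative_add, derivative_C, add_zero, derivative_map, coeff_map, natDegree_C]
  · intro i
    rw [derivative_add, derivative_C, add_zero, derivative_map]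
    have : ((e + 2 : ℕ) : ℂ[X][X][X]) * (q.map C + C X) - X * (derivative q).map C =
        (((e + 2 : ℕ) : ℂ[X][X]) * q - X * derivative q).map C + C (((e + 2 : ℕ) : ℂ[X][X]) * X) := by
      rw [C_mul, C_eq_natCast, Polynomial.map_sub, Polynomial.map_mul, Polynomial.map_mul,
        Polynomial.map_natCast, Polynomial.map_X]; ring
    rw [this, coeff_add, coeff_map]
    refine natDegree_add_le_of_degree_le ((natDegree_C _).le.trans (by omega)) ?_
    rw [coeff_C]
    split_ifs
    · refine natDegree_mul_le.trans ?_
      rw [natDegree_natCast, natDegree_X]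
    · simp

lemma D4_fx' (e : ℕ) : D4 (e + 4) (fxF ℂ[X] e) (fxG e X) (v0 ℂ[X]) ≠ 0 := by
  set μ := nthRootsFinset (e + 1) (1 : ℂ)
  have hcard : μ.card = e + 1 :=
    (Complex.isPrimitiveRoot_exp (e + 1) (by omega)).card_nthRootsFinset
  have he1 : ((e : ℂ) + 1) ≠ 0 := by exact_mod_cast Nat.succ_ne_zero e
  refine resultant_ne_of _ _ (e + 1) (by
      have : e + 4 - 3 = e + 1 := by omega
      rw [this]; positivity) (RR_fx_natDegree e) (D3_fx' e) (RR_fx_swap e)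
    (μ.image (fun z => (e + 1) * z - 1)) ?_ ?_ ?_
  · rw [Finset.card_image_of_injective, hcard]
    intro z w h
    have : ((e : ℂ) + 1) * (z - w) = 0 := by simp only at h; linear_combination h
    have := (mul_eq_zero.mp this).resolve_left he1
    linear_combination this
  · intro c hc
    obtain ⟨z, hz, rfl⟩ := Finset.mem_image.mp hc
    rw [mem_nthRootsFinset (by omega)] at hz
    rw [RR_fx_eval, D_eq_zero_iff (e + 2) (by omega) _
      (by rw [natDegree_add_C]; exact pfx_natDegree e 1)
      (by left; simp [pfx, coeff_X_pow, coeff_X, coeff_one])]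
    refine ⟨z, ?_, ?_⟩
    · simp [pfx]
      linear_combination z * hz
    · simp [pfx]
      linear_combination (e + 2) * hz
  · intro x h0
    obtain ⟨c, hc⟩ := D_add_C (e + 2) (by omega) _ (pfx_natDegree e x) (pfx_coeff e x)
    apply hc
    rw [← RR_fx_eval, h0, eval_zero]

lemma D3_three {A : Type*} [CommRing A] (F G : MvPolynomial (Fin 3) A) (v : Fin 3 → A) :
    D3 3 F G v = 1 := by
  simp [D3, RR, D]

lemma D4_three {A : Type*} [CommRing A] (F G : MvPolynomial (Fin 3) A) (v : Fin 3 → A) :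
    D4 3 F G v = 1 := by
  simp [D4]

end SecondTangency
namespace SecondTangency

/-- exponents of degree `d` -/
abbrev Idx (d : ℕ) : Type := ↥(Finset.finsuppAntidiag (Finset.univ : Finset (Fin 3)) d)

lemma Idx_sum {d : ℕ} (m : Idx d) : ∑ i, m.1 i = d := (Finset.mem_finsuppAntidiag.mp m.2).1

abbrev Sig (d : ℕ) : Type := Idx d ⊕ Idx d

section
variable {A : Type*} [CommRing A] {d : ℕ}

/-- the form with given coefficients -/
def ofC (c : Idx d → A) : MvPolynomial (Fin 3) A := ∑ m : Idx d, MvPolynomial.monomial m.1 (c m)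

lemma weight_one (m : Fin 3 →₀ ℕ) : Finsupp.weight (1 : Fin 3 → ℕ) m = ∑ i, m i := by
  rw [Finsupp.weight_apply, Finsupp.sum_fintype _ _ (by simp)]; simp

lemma ofC_hom (c : Idx d → A) : (ofC c).IsHomogeneous d := by
  refine MvPolynomial.IsHomogeneous.sum _ _ _ fun m _ => ?_
  apply MvPolynomial.isHomogeneous_monomial
  rw [Finsupp.degree_eq_sum]; exact Idx_sum m

lemma coeff_ofC (c : Idx d → A) (m : Idx d) : MvPolynomial.coeff m.1 (ofC c) = c m := by
  classical
  rw [ofC, MvPolynomial.coeff_sum, Finset.sum_eq_single m]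
  · simp
  · intro b _ hb
    rw [MvPolynomial.coeff_monomial, if_neg]
    exact fun h => hb (Subtype.ext h)
  · simp

lemma ofC_coeff (F : MvPolynomial (Fin 3) A) (hF : F.IsHomogeneous d) :
    ofC (fun m : Idx d => MvPolynomial.coeff m.1 F) = F := by
  ext m
  by_cases hm : ∑ i, m i = d
  · exact coeff_ofC _ ⟨m, Finset.mem_finsuppAntidiag.mpr ⟨hm, by simp⟩⟩
  · have h : ∀ G : MvPolynomial (Fin 3) A, G.IsHomogeneous d → MvPolynomial.coeff m G = 0 := by
      intro G hG
      by_contra h0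
      exact hm ((weight_one m).symm.trans (hG h0))
    rw [h _ (ofC_hom _), h _ hF]

lemma map_ofC {B : Type*} [CommRing B] (f : A →+* B) (c : Idx d → A) :
    MvPolynomial.map f (ofC c) = ofC (f ∘ c) := by
  simp [ofC, MvPolynomial.map_monomial]

/-- value of a monomial -/
def mon (v : Fin 3 → A) (m : Idx d) : A := ∏ i, v i ^ m.1 i

lemma eval_ofC (c : Idx d → A) (v : Fin 3 → A) :
    MvPolynomial.eval v (ofC c) = ∑ m, c m * mon v m := by
  rw [ofC, map_sum]
  refine Finset.sum_congr rfl fun m _ => ?_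
  rw [MvPolynomial.eval_monomial, mon, Finsupp.prod_fintype _ _ (by simp)]

lemma mon_map {B : Type*} [CommRing B] (f : A →+* B) (v : Fin 3 → A) (m : Idx d) :
    f (mon v m) = mon (f ∘ v) m := by simp [mon]

/-- the pure power -/
def corner (d : ℕ) (i : Fin 3) : Idx d := ⟨Finsupp.single i d, by
  rw [Finset.mem_finsuppAntidiag]
  refine ⟨?_, by simp⟩
  simp⟩

lemma mon_corner (v : Fin 3 → A) (i : Fin 3) (hv : v i = 1) : mon v (corner d i) = 1 := by
  rw [mon]
  apply Finset.prod_eq_one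
  intro j _
  by_cases h : i = j
  · subst h; simp [hv]
  · simp [corner, Finsupp.single_apply, h]

/-- solve for the corner coefficient -/
def cc (i : Fin 3) (a : Idx d → A) (v : Fin 3 → A) (m : Idx d) : A :=
  if m = corner d i then -∑ m' ∈ Finset.univ.erase (corner d i), a m' * mon v m' else a m

lemma cc_map {B : Type*} [CommRing B] (f : A →+* B) (i : Fin 3) (a : Idx d → A) (v : Fin 3 → A)
    (m : Idx d) : f (cc i a v m) = cc i (f ∘ a) (f ∘ v) m := by
  unfold cc
  split_ifs
  · simp [mon_map]
  · rfl

lemma cc_eq (i : Fin 3) (F : MvPolynomial (Fin 3) A) (hF : F.IsHomogeneous d) (v : Fin 3 → A)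
    (hv : v i = 1) (hFv : MvPolynomial.eval v F = 0) (a : Idx d → A)
    (ha : ∀ m, m ≠ corner d i → a m = MvPolynomial.coeff m.1 F) (m : Idx d) :
    cc i a v m = MvPolynomial.coeff m.1 F := by
  unfold cc
  split_ifs with h
  · rw [← ofC_coeff F hF, eval_ofC, ← Finset.add_sum_erase _ _ (Finset.mem_univ (corner d i)),
      mon_corner v i hv, mul_one] at hFv
    rw [h, neg_eq_iff_add_eq_zero, add_comm, ← hFv]
    congr 1
    refine Finset.sum_congr rfl fun m' hm' => ?_
    rw [ha m' (Finset.ne_of_mem_erase hm')]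
  · exact ha m h

/-- coefficient vector -/
def co (d : ℕ) (F G : MvPolynomial (Fin 3) A) : Sig d → A :=
  Sum.elim (fun m => MvPolynomial.coeff m.1 F) (fun m => MvPolynomial.coeff m.1 G)

/-- parameters -/
def para (d : ℕ) (i : Fin 3) (F G : MvPolynomial (Fin 3) A) (v : Fin 3 → A) : Sig d → A :=
  Sum.elim (fun m => if m = corner d i then v (i.succAbove 0) else MvPolynomial.coeff m.1 F)
    (fun m => if m = corner d i then v (i.succAbove 1) else MvPolynomial.coeff m.1 G)
end

/-- the universal point -/
def vU (d : ℕ) (i : Fin 3) : Fin 3 → MvPolynomial (Sig d) ℂ :=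
  i.insertNth (α := fun _ => MvPolynomial (Sig d) ℂ) 1 ![MvPolynomial.X (Sum.inl (corner d i)), MvPolynomial.X (Sum.inr (corner d i))]

/-- the universal coefficients -/
def eU (d : ℕ) (i : Fin 3) : Sig d → MvPolynomial (Sig d) ℂ :=
  Sum.elim (cc i (fun m => MvPolynomial.X (Sum.inl m)) (vU d i))
    (cc i (fun m => MvPolynomial.X (Sum.inr m)) (vU d i))

section
variable {A : Type*} [CommRing A] [Algebra ℂ A] {d : ℕ} (i : Fin 3)
  (F G : MvPolynomial (Fin 3) A)

lemma vU_aeval (v : Fin 3 → A) (hv : v i = 1) : (MvPolynomial.aeval (R := ℂ) (para d i F G v)).toRingHom ∘ vU d i = v := by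
  ext j
  induction j using Fin.succAboveCases i with
  | x => simp [vU, hv]
  | p j => fin_cases j <;> simp [vU, para]

lemma eU_aeval (hF : F.IsHomogeneous d) (hG : G.IsHomogeneous d) (v : Fin 3 → A)
    (hv : v i = 1) (hFv : MvPolynomial.eval v F = 0) (hGv : MvPolynomial.eval v G = 0) : (MvPolynomial.aeval (R := ℂ) (para d i F G v)).toRingHom ∘ eU d i = co d F G := by
  ext s
  rcases s with m | m
  · simp only [Function.comp, eU, Sum.elim_inl, co]
    rw [cc_map, vU_aeval i F G v hv]
    apply cc_eq i F hF v hv hFv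
    intro m hm
    simp [para, hm]
  · simp only [Function.comp, eU, Sum.elim_inr, co]
    rw [cc_map, vU_aeval i F G v hv]
    apply cc_eq i G hG v hv hGv
    intro m hm
    simp [para, hm]

lemma FU_aeval (hF : F.IsHomogeneous d) (hG : G.IsHomogeneous d) (v : Fin 3 → A)
    (hv : v i = 1) (hFv : MvPolynomial.eval v F = 0) (hGv : MvPolynomial.eval v G = 0) : MvPolynomial.map (MvPolynomial.aeval (R := ℂ) (para d i F G v)).toRingHom
    (ofC (eU d i ∘ Sum.inl)) = F := by
  rw [map_ofC, ← Function.comp_assoc, eU_aeval i F G hF hG v hv hFv hGv]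
  exact ofC_coeff F hF

lemma GU_aeval (hF : F.IsHomogeneous d) (hG : G.IsHomogeneous d) (v : Fin 3 → A)
    (hv : v i = 1) (hFv : MvPolynomial.eval v F = 0) (hGv : MvPolynomial.eval v G = 0) : MvPolynomial.map (MvPolynomial.aeval (R := ℂ) (para d i F G v)).toRingHom
    (ofC (eU d i ∘ Sum.inr)) = G := by
  rw [map_ofC, ← Function.comp_assoc, eU_aeval i F G hF hG v hv hFv hGv]
  exact ofC_coeff G hG
end

lemma chart (d : ℕ) (i : Fin 3) (E : MvPolynomial (Sig d) ℂ) (hE : E ≠ 0) :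
    ∃ Q : MvPolynomial (Sig d) ℂ, Q ≠ 0 ∧ ∀ F G : MvPolynomial (Fin 3) ℂ, F.IsHomogeneous d →
      G.IsHomogeneous d → ∀ v : Fin 3 → ℂ, v i = 1 → MvPolynomial.eval v F = 0 →
      MvPolynomial.eval v G = 0 → MvPolynomial.eval (co d F G) Q ≠ 0 →
      MvPolynomial.aeval (para d i F G v) E ≠ 0 := by
  obtain ⟨Q, hQ, k, hk⟩ := exists_dvd_aeval (eU d i) E hE
  refine ⟨Q, hQ, fun F G hF hG v hv hFv hGv hne h0 => hne ?_⟩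
  have h := congrArg (MvPolynomial.aeval (R := ℂ) (para d i F G v)) hk
  rw [map_mul, h0, zero_mul] at h
  rw [← eU_aeval i F G hF hG v hv hFv hGv, ← h, ← MvPolynomial.coe_aeval_eq_eval]
  have h2 := MvPolynomial.comp_aeval_apply (R := ℂ) (f := eU d i)
    (MvPolynomial.aeval (R := ℂ) (para d i F G v)) Q
  exact h2.symm

/-- total discriminant -/
def DT {A : Type*} [CommRing A] (d : ℕ) (F G : MvPolynomial (Fin 3) A) (v : Fin 3 → A) : A :=
  D1 d F G v * D2 d F G v * (D3 d F G v * D4 d F G v)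

lemma DT_map {A B : Type*} [CommRing A] [CommRing B] (f : A →+* B) (d : ℕ)
    (F G : MvPolynomial (Fin 3) A) (v : Fin 3 → A) :
    f (DT d F G v) = DT d (MvPolynomial.map f F) (MvPolynomial.map f G) (f ∘ v) := by
  simp only [DT, map_mul, D1_map, D2_map, D3_map, D4_map]

lemma DT_ne (d : ℕ) (hd : 3 ≤ d) :
    DT d (ofC (eU d 2 ∘ Sum.inl)) (ofC (eU d 2 ∘ Sum.inr)) (vU d 2) ≠ 0 := by
  obtain ⟨e, rfl⟩ : ∃ e, d = e + 3 := ⟨d - 3, by omega⟩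
  have key : ∀ {A : Type} [CommRing A] [Algebra ℂ A] (F G : MvPolynomial (Fin 3) A),
      F.IsHomogeneous (e + 3) → G.IsHomogeneous (e + 3) →
      MvPolynomial.eval (v0 A) F = 0 → MvPolynomial.eval (v0 A) G = 0 →
      ∃ f : MvPolynomial (Sig (e + 3)) ℂ →+* A,
        MvPolynomial.map f (ofC (eU (e + 3) 2 ∘ Sum.inl)) = F ∧
        MvPolynomial.map f (ofC (eU (e + 3) 2 ∘ Sum.inr)) = G ∧ f ∘ vU (e + 3) 2 = v0 A := by
    intro A _ _ F G hF hG h1 h2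
    have hv : v0 A 2 = 1 := by simp [v0]
    exact ⟨_, FU_aeval 2 F G hF hG _ hv h1 h2, GU_aeval 2 F G hF hG _ hv h1 h2,
      vU_aeval 2 F G _ hv⟩
  refine mul_ne_zero (mul_ne_zero ?_ ?_) ?_
  · obtain ⟨f, f1, f2, f3⟩ := key _ _ (exF_hom (A := ℂ) e) (exG_hom e) (ex_eval0 e).1 (ex_eval0 e).2
    intro h
    apply D1_ex e
    have := D1_map f (e + 3) (ofC (eU (e + 3) 2 ∘ Sum.inl)) (ofC (eU (e + 3) 2 ∘ Sum.inr))
      (vU (e + 3) 2)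
    rw [h, map_zero, f1, f2, f3] at this
    exact this.symm
  · obtain ⟨f, f1, f2, f3⟩ := key _ _ (exF_hom (A := ℂ) e) (exG_hom e) (ex_eval0 e).1 (ex_eval0 e).2
    intro h
    apply D2_ex e
    have := D2_map f (e + 3) (ofC (eU (e + 3) 2 ∘ Sum.inl)) (ofC (eU (e + 3) 2 ∘ Sum.inr))
      (vU (e + 3) 2)
    rw [h, map_zero, f1, f2, f3] at this
    exact this.symm
  · cases e with
    | zero => simp only [Nat.zero_add, D3_three, D4_three]; norm_num
    | succ e =>
      obtain ⟨f, f1, f2, f3⟩ := key _ _ (fxF_hom (A := Polynomial ℂ) e) (fxG_hom e Polynomial.X)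
        (fx_eval0 e Polynomial.X).1 (fx_eval0 e Polynomial.X).2
      refine mul_ne_zero ?_ ?_
      · intro h
        apply D3_fx' e
        have := D3_map f (e + 4) (ofC (eU (e + 4) 2 ∘ Sum.inl)) (ofC (eU (e + 4) 2 ∘ Sum.inr))
          (vU (e + 4) 2)
        rw [f1, f2, f3] at this
        rw [← this]
        exact (congrArg f h).trans (map_zero f)
      · intro h
        apply D4_fx' e
        have := D4_map f (e + 4) (ofC (eU (e + 4) 2 ∘ Sum.inl)) (ofC (eU (e + 4) 2 ∘ Sum.inr))
          (vU (e + 4) 2)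
        rw [f1, f2, f3] at this
        rw [← this]
        exact (congrArg f h).trans (map_zero f)

/-- generic pencils -/
lemma generic (d : ℕ) (hd : 3 ≤ d) : ∃ Q : MvPolynomial (Sig d) ℂ, Q ≠ 0 ∧
    ∀ F G : MvPolynomial (Fin 3) ℂ, F.IsHomogeneous d → G.IsHomogeneous d →
      MvPolynomial.eval (co d F G) Q ≠ 0 → LinearIndependent ℂ ![F, G] ∧
      ∀ v : Fin 3 → ℂ, v ≠ 0 → MvPolynomial.eval v F = 0 → MvPolynomial.eval v G = 0 →
        (membersWithSecondTangency F G v).Finite ∧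
          (membersWithSecondTangency F G v).ncard = (d - 3) * (d + 4) := by
  classical
  obtain ⟨Q0, hQ0, h0⟩ := chart d 0 (MvPolynomial.X (Sum.inr (corner d 0))) (MvPolynomial.X_ne_zero _)
  obtain ⟨Q1, hQ1, h1⟩ := chart d 1 (MvPolynomial.X (Sum.inr (corner d 1))) (MvPolynomial.X_ne_zero _)
  obtain ⟨Q2, hQ2, h2⟩ := chart d 2 _ (DT_ne d hd)
  have hcor : corner d 0 ≠ corner d 1 := by
    intro h
    have := congrArg (fun m : Idx d => m.1 0) h
    simp [corner] at this
    omega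
  set L : MvPolynomial (Sig d) ℂ :=
    MvPolynomial.X (Sum.inl (corner d 0)) * MvPolynomial.X (Sum.inr (corner d 1)) -
    MvPolynomial.X (Sum.inl (corner d 1)) * MvPolynomial.X (Sum.inr (corner d 0)) with hL
  have hL0 : L ≠ 0 := by
    intro h
    have := congrArg (MvPolynomial.eval (Sum.elim (fun m => if m = corner d 0 then (1 : ℂ) else 0)
      (fun m => if m = corner d 1 then 1 else 0))) h
    simp [hL, hcor] at this
  refine ⟨Q0 * Q1 * Q2 * L, mul_ne_zero (mul_ne_zero (mul_ne_zero hQ0 hQ1) hQ2) hL0, ?_⟩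
  intro F G hF hG hne
  rw [map_mul, map_mul, map_mul] at hne
  have n0 : MvPolynomial.eval (co d F G) Q0 ≠ 0 := fun h => hne (by rw [h]; ring)
  have n1 : MvPolynomial.eval (co d F G) Q1 ≠ 0 := fun h => hne (by rw [h]; ring)
  have n2 : MvPolynomial.eval (co d F G) Q2 ≠ 0 := fun h => hne (by rw [h]; ring)
  have nL : MvPolynomial.eval (co d F G) L ≠ 0 := fun h => hne (by rw [h]; ring)
  constructor
  · rw [LinearIndependent.pair_iff]
    intro a b hab
    have e0 := congrArg (MvPolynomial.coeff (corner d 0).1) hab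
    have e1 := congrArg (MvPolynomial.coeff (corner d 1).1) hab
    simp [hL, co] at nL e0 e1
    set p := MvPolynomial.coeff (corner d 0).1 F
    set q := MvPolynomial.coeff (corner d 0).1 G
    set r := MvPolynomial.coeff (corner d 1).1 F
    set s := MvPolynomial.coeff (corner d 1).1 G
    have k0 : a * (p * s - r * q) = 0 := by linear_combination s * e0 - q * e1
    have k1 : b * (p * s - r * q) = 0 := by linear_combination p * e1 - r * e0
    exact ⟨(mul_eq_zero.mp k0).resolve_right nL, (mul_eq_zero.mp k1).resolve_right nL⟩
  · intro v hv hFv hGv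
    have hsc : ∀ c : ℂ, MvPolynomial.eval (fun i => c * v i) F = 0 ∧
        MvPolynomial.eval (fun i => c * v i) G = 0 := by
      intro c
      rw [hom_eval hF, hom_eval hG, hFv, hGv]; simp
    have hv2 : v 2 ≠ 0 := by
      intro hv2
      by_cases hv0 : v 0 = 0
      · have hv1 : v 1 ≠ 0 := by
          intro hv1; apply hv; ext i; fin_cases i <;> simp [hv0, hv1, hv2]
        refine h1 F G hF hG (fun i => (v 1)⁻¹ * v i) (by simp [hv1]) (hsc _).1 (hsc _).2 n1 ?_
        have : (1 : Fin 3).succAbove 1 = 2 := by decide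
        simp [para, this, hv2]
      · refine h0 F G hF hG (fun i => (v 0)⁻¹ * v i) (by simp [hv0]) (hsc _).1 (hsc _).2 n0 ?_
        have : (0 : Fin 3).succAbove 1 = 2 := by decide
        simp [para, hv2]
    have hw : (fun i => (v 2)⁻¹ * v i) 2 = 1 := by simp [hv2]
    have hD := h2 F G hF hG _ hw (hsc _).1 (hsc _).2 n2
    have hD' := DT_map (MvPolynomial.aeval (R := ℂ) (para d 2 F G (fun i => (v 2)⁻¹ * v i))).toRingHom d
      (ofC (eU d 2 ∘ Sum.inl)) (ofC (eU d 2 ∘ Sum.inr)) (vU d 2)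
    rw [FU_aeval 2 F G hF hG _ hw (hsc _).1 (hsc _).2, GU_aeval 2 F G hF hG _ hw (hsc _).1 (hsc _).2,
      vU_aeval 2 F G _ hw] at hD'
    have hD2 : DT d F G (fun i => (v 2)⁻¹ * v i) ≠ 0 := by
      rw [← hD']; exact hD
    rw [← members_scale hF hG hd v (v 2)⁻¹ (inv_ne_zero hv2)]
    exact count_main hF hG hd _ hw (hsc _).1 (hsc _).2
      (left_ne_zero_of_mul (left_ne_zero_of_mul hD2)) (right_ne_zero_of_mul (left_ne_zero_of_mul hD2))
      (left_ne_zero_of_mul (right_ne_zero_of_mul hD2)) (right_ne_zero_of_mul (right_ne_zero_of_mul hD2))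

end SecondTangency
/-- For a general pencil of degree-`d` plane curves and any base point `[v]` of the
pencil, the number of members `C` which are smooth at `[v]` and whose tangent line
at `[v]` is tangent to `C` at a second point distinct from `[v]` is exactly
`(d − 3)(d + 4) = d² + d − 12`. -/
theorem second_tangency_at_base_point_count (d : ℕ) (hd : 3 ≤ d) :
    ∃ Q : MvPolynomial ((Fin 3 →₀ ℕ) ⊕ (Fin 3 →₀ ℕ)) ℂ,
      (∃ F G : MvPolynomial (Fin 3) ℂ, F.IsHomogeneous d ∧ G.IsHomogeneous d ∧
          LinearIndependent ℂ ![F, G] ∧ MvPolynomial.eval (coeffs2 F G) Q ≠ 0) ∧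
      ∀ F G : MvPolynomial (Fin 3) ℂ, F.IsHomogeneous d → G.IsHomogeneous d →
        LinearIndependent ℂ ![F, G] → MvPolynomial.eval (coeffs2 F G) Q ≠ 0 →
          ∀ v : Fin 3 → ℂ, v ≠ 0 →
            MvPolynomial.eval v F = 0 → MvPolynomial.eval v G = 0 →
              (membersWithSecondTangency F G v).Finite ∧
                ((membersWithSecondTangency F G v).ncard : ℤ) =
                  ((d : ℤ) - 3) * ((d : ℤ) + 4) ∧
                ((d : ℤ) - 3) * ((d : ℤ) + 4) = (d : ℤ) ^ 2 + (d : ℤ) - 12 := by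
  obtain ⟨Q, hQ, h⟩ := SecondTangency.generic d hd
  have hev : ∀ F G : MvPolynomial (Fin 3) ℂ, MvPolynomial.eval (coeffs2 F G)
      (MvPolynomial.rename (Sum.map Subtype.val Subtype.val) Q) =
      MvPolynomial.eval (SecondTangency.co d F G) Q := by
    intro F G
    rw [MvPolynomial.eval_rename]
    congr 2
    funext s
    rcases s with s | s <;> rfl
  refine ⟨MvPolynomial.rename (Sum.map Subtype.val Subtype.val) Q, ?_, ?_⟩
  · obtain ⟨p, hp⟩ : ∃ p, MvPolynomial.eval p Q ≠ 0 := by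
      by_contra hc
      push Not at hc
      exact hQ (MvPolynomial.funext fun p => by rw [hc p, map_zero])
    have hco : SecondTangency.co d (SecondTangency.ofC (p ∘ Sum.inl))
        (SecondTangency.ofC (p ∘ Sum.inr)) = p := by
      funext s
      rcases s with s | s
      · exact SecondTangency.coeff_ofC (p ∘ Sum.inl) s
      · exact SecondTangency.coeff_ofC (p ∘ Sum.inr) s
    have h1 := SecondTangency.ofC_hom (p ∘ Sum.inl)
    have h2 := SecondTangency.ofC_hom (p ∘ Sum.inr)
    have h3 := hp
    rw [← hco] at h3
    exact ⟨_, _, h1, h2, (h _ _ h1 h2 h3).1, by rw [hev]; exact h3⟩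
  · intro F G hF hG _ hne v hv hFv hGv
    rw [hev] at hne
    obtain ⟨hfin, hcard⟩ := (h F G hF hG hne).2 v hv hFv hGv
    refine ⟨hfin, ?_, by ring⟩
    rw [hcard]
    push_cast [Nat.cast_sub hd]
    ring
end
end

section
/- Let d ≥ 3 be an integer and fix a point q ∈ ℙ²(ℂ). For a general plane curve C of degree d singular at q (i.e., C = {F = 0} with F a general member of the linear space of degree-d forms all of whose first partial derivatives vanish at q), the number of lines through q that are tangent to C at some point distinct from q is exactly (d − 3)(d + 2) = d² − d − 6. -/
noncomputable section

/-- The coefficient vector of a single form. -/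
def coeffs1 (F : MvPolynomial (Fin 3) ℂ) : (Fin 3 →₀ ℕ) → ℂ :=
  fun m => MvPolynomial.coeff m F

/-- The set of lines through the point `[q]` (2-dimensional linear subspaces of `ℂ³`
containing `q`) which are tangent to the curve `{F = 0}` at some point distinct
from `[q]`.  (Such a line is spanned by `q` and the tangency point `[u]`, and the
contact condition at `[u]` is taken along the direction `q`.) -/
def tangentLinesThroughNode (F : MvPolynomial (Fin 3) ℂ) (q : Fin 3 → ℂ) :
    Set (Submodule ℂ (Fin 3 → ℂ)) :=
  {W | Module.finrank ℂ ↥W = 2 ∧ q ∈ W ∧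
    ∃ u : Fin 3 → ℂ, u ∈ W ∧ LinearIndependent ℂ ![u, q] ∧ ContactLE F u q 2}


section node_helpers

open Polynomial


def dsc {S : Type*} [CommRing S] (k : ℕ) (f : S[X]) : S :=
  resultant (C ((k : S) + 1) * f - X * derivative f) (derivative f) k k

lemma dsc_map {S T : Type*} [CommRing S] [CommRing T] (φ : S →+* T) (k : ℕ) (f : S[X]) :
    dsc k (f.map φ) = φ (dsc k f) := by
  unfold dsc
  have h : C ((k : T) + 1) * f.map φ - X * derivative (f.map φ) =
      (C ((k : S) + 1) * f - X * derivative f).map φ := by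
    simp [Polynomial.derivative_map]
  rw [h, Polynomial.derivative_map, resultant_map_map]

lemma resultant_comp_scale {S : Type*} [CommRing S] (f g : S[X]) (m n : ℕ) (r : S) :
    resultant (f.comp (C r * X)) (g.comp (C r * X)) m n *
      (r ^ (∑ j : Fin m, (j : ℕ)) * r ^ (∑ j : Fin n, (j : ℕ))) =
      r ^ (∑ j : Fin (m + n), (j : ℕ)) * resultant f g m n := by
  have key : sylvester (f.comp (C r * X)) (g.comp (C r * X)) m n *
      Matrix.diagonal (fun j : Fin (m + n) => (Fin.addCases (fun j₁ => r ^ (j₁ : ℕ))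
        (fun j₁ => r ^ (j₁ : ℕ)) j : S)) =
      Matrix.diagonal (fun i : Fin (m + n) => r ^ (i : ℕ)) * sylvester f g m n := by
    ext i j
    rw [Matrix.mul_diagonal, Matrix.diagonal_mul]
    induction j using Fin.addCases with
    | left j =>
      simp only [sylvester, Matrix.of_apply, Fin.addCases_left, comp_C_mul_X_coeff]
      split_ifs with h
      · rw [mul_assoc, ← pow_add, Nat.sub_add_cancel h.1, mul_comm]
      · simp
    | right j =>
      simp only [sylvester, Matrix.of_apply, Fin.addCases_right, comp_C_mul_X_coeff]
      split_ifs with h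
      · rw [mul_assoc, ← pow_add, Nat.sub_add_cancel h.1, mul_comm]
      · simp
  have := congrArg Matrix.det key
  rw [Matrix.det_mul, Matrix.det_mul, Matrix.det_diagonal, Matrix.det_diagonal,
    Fin.prod_univ_add] at this
  simp only [Fin.addCases_left, Fin.addCases_right, Finset.prod_pow_eq_pow_sum] at this
  exact this

lemma sum_fin_aux (k : ℕ) : ∑ j : Fin (k + k), (j : ℕ) =
    (∑ j : Fin k, (j : ℕ)) + (∑ j : Fin k, (j : ℕ)) + k * k := by
  rw [Fin.sum_univ_add]
  simp [Finset.sum_add_distrib]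
  ring

lemma dsc_scale (k : ℕ) (f h : ℂ[X]) (r : ℂ) (hr : r ≠ 0)
    (H : h.comp (C r * X) = C (r ^ (k + 3)) * f) : dsc k h = r ^ (k * (k + 5)) * dsc k f := by
  have h1 := resultant_comp_scale (C ((k : ℂ) + 1) * h - X * derivative h) (derivative h) k k r
  have hd : C r * (derivative h).comp (C r * X) = C (r ^ (k + 3)) * derivative f := by
    have := congrArg derivative H
    rw [derivative_comp] at this
    rw [derivative_C_mul, derivative_C_mul, derivative_X, mul_one] at this
    exact this
  have e1 : (C ((k : ℂ) + 1) * h - X * derivative h).comp (C r * X) =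
      C (r ^ (k + 3)) * (C ((k : ℂ) + 1) * f - X * derivative f) := by
    simp only [sub_comp, mul_comp, C_comp, X_comp, H]
    linear_combination (-X) * hd
  have e2 : (derivative h).comp (C r * X) = C (r ^ (k + 2)) * derivative f := by
    have hC : (C r : ℂ[X]) ≠ 0 := by simpa using hr
    apply mul_left_cancel₀ hC
    rw [hd, ← mul_assoc, ← C_mul]
    congr 2; ring
  rw [e1, e2, resultant_C_mul_left, resultant_C_mul_right, sum_fin_aux] at h1
  have hne : r ^ ((∑ j : Fin k, (j : ℕ)) + (∑ j : Fin k, (j : ℕ)) + k * k) ≠ 0 := pow_ne_zero _ hr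
  apply mul_left_cancel₀ hne
  unfold dsc
  rw [← h1, pow_add, pow_add]
  ring

lemma dsc_prod (k : ℕ) (f : ℂ[X]) (hf : f.natDegree ≤ k + 1) (h0 : f.coeff (k + 1) ≠ 0) :
    dsc k f = (-1) ^ (k * k) * ((((k : ℂ) + 1) * f.coeff (k + 1)) ^ k *
      ((derivative f).roots.map (fun z => ((k : ℂ) + 1) * f.eval z)).prod) := by
  have hc : (derivative f).coeff k ≠ 0 := by
    rw [coeff_derivative]
    exact mul_ne_zero h0 (by exact_mod_cast Nat.succ_ne_zero k)
  have hd : (derivative f).natDegree = k :=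
    le_antisymm ((natDegree_derivative_le f).trans (by omega)) (le_natDegree_of_ne_zero hc)
  have hA : (C ((k : ℂ) + 1) * f - X * derivative f).natDegree ≤ k := by
    rw [natDegree_le_iff_coeff_eq_zero]
    intro j hj
    obtain ⟨j, rfl⟩ := Nat.exists_eq_succ_of_ne_zero (by omega : j ≠ 0)
    simp only [coeff_sub, coeff_C_mul, Nat.succ_eq_add_one, coeff_X_mul, coeff_derivative]
    rcases Nat.lt_or_ge (k + 1) (j + 1) with h | h
    · rw [coeff_eq_zero_of_natDegree_lt (by omega)]; simp
    · have : j = k := by omega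
      subst this; ring
  unfold dsc
  rw [resultant_comm]
  congr 1
  have := resultant_eq_prod_eval (derivative f) (C ((k : ℂ) + 1) * f - X * derivative f) k hA
    (IsAlgClosed.splits _)
  rw [hd] at this
  rw [this, leadingCoeff, hd, coeff_derivative, mul_comm (f.coeff (k+1))]
  congr 2
  apply Multiset.map_congr rfl
  intro z hz
  have := isRoot_of_mem_roots hz
  rw [IsRoot] at this
  simp [this]

lemma dsc_iff (k : ℕ) (f : ℂ[X]) (hf : f.natDegree ≤ k + 1)
    (h : f.coeff (k + 1) ≠ 0 ∨ f.coeff k ≠ 0) :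
    dsc k f = 0 ↔ ∃ z, f.eval z = 0 ∧ (derivative f).eval z = 0 := by
  have hk : (k : ℂ) + 1 ≠ 0 := by exact_mod_cast Nat.succ_ne_zero k
  by_cases h0 : f.coeff (k + 1) = 0
  · have h1 : f.coeff k ≠ 0 := by tauto
    have hf' : f.natDegree ≤ k := by
      rw [natDegree_le_iff_coeff_eq_zero]
      intro j hj
      rcases Nat.lt_or_ge (k + 1) j with h | h
      · exact coeff_eq_zero_of_natDegree_lt (by omega)
      · have : j = k + 1 := by omega
        subst this; exact h0
    have hcA : (C ((k : ℂ) + 1) * f - X * derivative f).coeff k = f.coeff k := by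
      rcases k with _ | k
      · simp
      · simp only [coeff_sub, coeff_C_mul, coeff_X_mul, coeff_derivative]
        push_cast; ring
    have hA : (C ((k : ℂ) + 1) * f - X * derivative f).natDegree = k := by
      apply le_antisymm
      · refine (natDegree_sub_le _ _).trans (max_le ?_ ?_)
        · exact (natDegree_C_mul_le _ _).trans hf'
        · rw [natDegree_le_iff_coeff_eq_zero]
          intro j hj
          obtain ⟨j, rfl⟩ := Nat.exists_eq_succ_of_ne_zero (by omega : j ≠ 0)
          simp only [Nat.succ_eq_add_one, coeff_X_mul, coeff_derivative]
          rw [coeff_eq_zero_of_natDegree_lt (by omega)]; simp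
      · exact le_natDegree_of_ne_zero (by rwa [hcA])
    have hA0 : (C ((k : ℂ) + 1) * f - X * derivative f) ≠ 0 := by
      intro h; rw [h] at hcA; simp at hcA; exact h1 hcA.symm
    have := resultant_eq_prod_eval (C ((k : ℂ) + 1) * f - X * derivative f) (derivative f) k
      ((natDegree_derivative_le f).trans (by omega)) (IsAlgClosed.splits _)
    rw [hA] at this
    unfold dsc
    rw [this, mul_eq_zero, Multiset.prod_eq_zero_iff, leadingCoeff, hA, hcA, Multiset.mem_map]
    simp only [pow_eq_zero_iff', h1, false_and, false_or]
    constructor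
    · rintro ⟨z, hz, hz'⟩
      refine ⟨z, ?_, hz'⟩
      have := isRoot_of_mem_roots hz
      rw [IsRoot] at this
      simp [hz'] at this
      tauto
    · rintro ⟨z, hz, hz'⟩
      refine ⟨z, ?_, hz'⟩
      rw [mem_roots hA0]
      simp [hz, hz']
  · rw [dsc_prod k f hf h0]
    have hd0 : derivative f ≠ 0 := by
      intro hd
      have := coeff_derivative f k
      rw [hd] at this
      simp at this
      tauto
    simp only [mul_eq_zero, pow_eq_zero_iff', Multiset.prod_eq_zero_iff, Multiset.mem_map, hk, h0,
      false_or, false_and, neg_eq_zero, one_ne_zero]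
    constructor
    · rintro ⟨z, hz, hz'⟩
      exact ⟨z, hz', isRoot_of_mem_roots hz⟩
    · rintro ⟨z, hz, hz'⟩
      exact ⟨z, (mem_roots hd0).2 hz', hz⟩

lemma reversal (p r : ℂ[X]) (N : ℕ) (H : ∀ t : ℂ, t ≠ 0 → r.eval t = t ^ N * p.eval t⁻¹) :
    p.natDegree ≤ N ∧ ∀ j ≤ N, p.coeff j = r.coeff (N - j) := by
  set M := max N p.natDegree with hM
  have h1 : X ^ (M - N) * r = reflect M p := by
    apply eq_of_infinite_eval_eq
    apply Set.Infinite.mono (s := {0}ᶜ)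
    · intro t ht
      have ht : t ≠ 0 := by simpa using ht
      have := invertibleOfNonzero (inv_ne_zero ht)
      have := eval₂_reflect_mul_pow (RingHom.id ℂ) t⁻¹ M p (le_max_right _ _)
      simp only [eval₂_id, invOf_eq_inv, inv_inv] at this
      simp only [Set.mem_ofPred_eq, eval_mul, eval_pow, eval_X]
      rw [H t ht, ← this, ← mul_assoc, ← pow_add, Nat.sub_add_cancel (le_max_left _ _)]
      rw [inv_pow]
      field_simp
      rw [mul_comm]
    · exact (Set.finite_singleton _).infinite_compl
  have h2 : ∀ j ≤ M, p.coeff j = (X ^ (M - N) * r).coeff (M - j) := by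
    intro j hj
    rw [h1, coeff_reflect, revAt_le (Nat.sub_le _ _), Nat.sub_sub_self hj]
  have h3 : p.natDegree ≤ N := by
    by_contra hlt
    have hMp : M = p.natDegree := max_eq_right (by omega)
    have := h2 p.natDegree (by omega)
    rw [hMp, Nat.sub_self, mul_coeff_zero, coeff_zero_eq_eval_zero (X ^ _)] at this
    simp [show p.natDegree - N ≠ 0 by omega] at this
    rw [this] at hlt
    simp at hlt
  have hMN : M = N := max_eq_left h3
  refine ⟨h3, fun j hj => ?_⟩
  rw [h2 j (by omega), hMN]; simp

/-! ### restrictions to lines -/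

lemma eval_linePoly (F : MvPolynomial (Fin 3) ℂ) (u w : Fin 3 → ℂ) (t : ℂ) :
    (linePoly F u w).eval t = MvPolynomial.eval (u + t • w) F := by
  unfold linePoly
  rw [← Polynomial.coe_evalRingHom, ← AlgHom.coe_toRingHom, ← RingHom.comp_apply]
  congr 1
  apply MvPolynomial.ringHom_ext
  · intro r; simp
  · intro i; simp; ring

lemma eval_smul_of_homog {F : MvPolynomial (Fin 3) ℂ} {d : ℕ} (hF : F.IsHomogeneous d)
    (c : ℂ) (u : Fin 3 → ℂ) :
    MvPolynomial.eval (c • u) F = c ^ d * MvPolynomial.eval u F := by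
  rw [MvPolynomial.eval_eq, MvPolynomial.eval_eq, Finset.mul_sum]
  apply Finset.sum_congr rfl
  intro m hm
  have h1 := hF (MvPolynomial.mem_support_iff.mp hm)
  simp only [Pi.smul_apply, smul_eq_mul, mul_pow, Finset.prod_mul_distrib]
  rw [Finset.prod_pow_eq_pow_sum]
  have : ∑ i ∈ m.support, m i = d := by
    rw [← h1, Finsupp.weight_apply, Finsupp.sum]; simp
  rw [this]; ring

lemma linePoly_shift (F : MvPolynomial (Fin 3) ℂ) (u w : Fin 3 → ℂ) (c : ℂ) :
    linePoly F (u + c • w) w = (linePoly F u w).comp (X + C c) := by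
  apply Polynomial.funext
  intro t
  rw [eval_comp, eval_linePoly, eval_linePoly]
  congr 2
  ext i; simp; ring

lemma linePoly_scale {F : MvPolynomial (Fin 3) ℂ} {d : ℕ} (hF : F.IsHomogeneous d)
    (u w : Fin 3 → ℂ) (c : ℂ) :
    (linePoly F (c • u) w).comp (C c * X) = C (c ^ d) * linePoly F u w := by
  apply Polynomial.funext
  intro t
  rw [eval_comp, eval_linePoly, eval_mul (p := C (c ^ d)), eval_linePoly, eval_C, ← eval_smul_of_homog hF]
  congr 2
  ext i; simp; ring

lemma linePoly_reversal {F : MvPolynomial (Fin 3) ℂ} {d : ℕ} (hF : F.IsHomogeneous d)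
    (u w : Fin 3 → ℂ) :
    (linePoly F u w).natDegree ≤ d ∧
      ∀ j ≤ d, (linePoly F u w).coeff j = (linePoly F w u).coeff (d - j) := by
  apply reversal
  intro t ht
  rw [eval_linePoly, eval_linePoly, ← eval_smul_of_homog hF]
  congr 2
  ext i; simp; field_simp; ring

lemma derivative_linePoly (F : MvPolynomial (Fin 3) ℂ) (u w : Fin 3 → ℂ) :
    derivative (linePoly F u w) = ∑ i, C (w i) * linePoly (MvPolynomial.pderiv i F) u w := by
  induction F using MvPolynomial.induction_on with
  | C a => simp [linePoly]
  | add p q hp hq =>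
    have : linePoly (p + q) u w = linePoly p u w + linePoly q u w := by simp [linePoly]
    rw [this, derivative_add, hp, hq, ← Finset.sum_add_distrib]
    apply Finset.sum_congr rfl
    intro i _
    simp [linePoly]; ring
  | mul_X p j hp =>
    have : linePoly (p * MvPolynomial.X j) u w = linePoly p u w * (C (u j) + X * C (w j)) := by
      simp [linePoly]
    rw [this, derivative_mul, hp]
    have h2 : ∀ i, linePoly (MvPolynomial.pderiv i (p * MvPolynomial.X j)) u w =
        linePoly (MvPolynomial.pderiv i p) u w * (C (u j) + X * C (w j)) +
          linePoly p u w * (if i = j then 1 else 0) := by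
      intro i
      rw [Derivation.leibniz, MvPolynomial.pderiv_X]
      by_cases hij : i = j
      · subst hij; simp [linePoly]; ring
      · simp [linePoly, hij, Ne.symm hij]; ring
    simp only [h2, mul_add, Finset.sum_add_distrib]
    simp only [mul_ite, mul_one, mul_zero, Finset.sum_ite_eq', Finset.mem_univ, if_true]
    simp only [← mul_assoc, Finset.sum_mul, derivative_add, derivative_C, zero_add,
      derivative_mul, derivative_X, one_mul, mul_zero, add_zero]
    simp
    ring

lemma coeff_zero_linePoly (F : MvPolynomial (Fin 3) ℂ) (u w : Fin 3 → ℂ) :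
    (linePoly F u w).coeff 0 = MvPolynomial.eval u F := by
  rw [coeff_zero_eq_eval_zero, eval_linePoly]; simp

lemma coeff_one_linePoly (F : MvPolynomial (Fin 3) ℂ) (u w : Fin 3 → ℂ) :
    (linePoly F u w).coeff 1 = ∑ i, w i * MvPolynomial.eval u (MvPolynomial.pderiv i F) := by
  have := coeff_derivative (linePoly F u w) 0
  rw [derivative_linePoly] at this
  simp [-coeff_zero, coeff_zero_linePoly] at this
  rw [← this]

lemma linePoly_natDegree {F : MvPolynomial (Fin 3) ℂ} {k : ℕ} (hF : F.IsHomogeneous (k + 3))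
    {q : Fin 3 → ℂ} (hs : ∀ i : Fin 3, MvPolynomial.eval q (MvPolynomial.pderiv i F) = 0)
    (u : Fin 3 → ℂ) : (linePoly F u q).natDegree ≤ k + 1 := by
  obtain ⟨h1, h2⟩ := linePoly_reversal hF u q
  rw [natDegree_le_iff_coeff_eq_zero]
  intro j hj
  rcases Nat.lt_or_ge (k + 3) j with h | h
  · exact coeff_eq_zero_of_natDegree_lt (by omega)
  rw [h2 j h]
  have hcase : j = k + 3 ∨ j = k + 2 := by omega
  rcases hcase with rfl | rfl
  · rw [Nat.sub_self, coeff_zero_linePoly]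
    have e := congrArg (MvPolynomial.eval q) hF.sum_X_mul_pderiv
    simp [hs] at e
    rcases e with e | e
    · exfalso
      have : ((k + 3 : ℕ) : ℂ) = 0 := by push_cast; exact e
      exact absurd this (Nat.cast_ne_zero.2 (by omega))
    · exact e
  · rw [show k + 3 - (k + 2) = 1 by omega, coeff_one_linePoly]
    simp [hs]

lemma contact_iff (F : MvPolynomial (Fin 3) ℂ) (u q : Fin 3 → ℂ) :
    ContactLE F u q 2 ↔ (linePoly F u q).coeff 0 = 0 ∧ (linePoly F u q).coeff 1 = 0 := by
  unfold ContactLE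
  rw [X_pow_dvd_iff]
  constructor
  · intro h; exact ⟨h 0 (by norm_num), h 1 (by norm_num)⟩
  · rintro ⟨h0, h1⟩ j hj
    interval_cases j <;> assumption

lemma contact_smul {F : MvPolynomial (Fin 3) ℂ} {d : ℕ} (hF : F.IsHomogeneous d)
    (u q : Fin 3 → ℂ) (c : ℂ) (hc : c ≠ 0) :
    ContactLE F (c • u) q 2 ↔ ContactLE F u q 2 := by
  have h := linePoly_scale hF u q c
  have h0 := congrArg (fun p => coeff p 0) h
  have h1 := congrArg (fun p => coeff p 1) h
  simp only [comp_C_mul_X_coeff, coeff_C_mul] at h0 h1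
  rw [contact_iff, contact_iff]
  have hcd := pow_ne_zero d hc
  constructor
  · rintro ⟨a, b⟩
    rw [a] at h0; rw [b] at h1
    simp at h0 h1
    tauto
  · rintro ⟨a, b⟩
    rw [a] at h0; rw [b] at h1
    simp at h0 h1
    tauto

lemma contact_shift (F : MvPolynomial (Fin 3) ℂ) (u q : Fin 3 → ℂ) (z : ℂ) :
    ContactLE F (u + z • q) q 2 ↔
      (linePoly F u q).eval z = 0 ∧ (derivative (linePoly F u q)).eval z = 0 := by
  rw [contact_iff, linePoly_shift]
  have h1 := coeff_derivative ((linePoly F u q).comp (X + C z)) 0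
  rw [derivative_comp] at h1
  simp only [coeff_zero_eq_eval_zero, eval_comp, eval_mul, eval_add, eval_X, eval_C,
    derivative_add, derivative_X, derivative_C] at h1 ⊢
  simp at h1 ⊢
  rw [← h1]
  exact fun _ => Iff.rfl

/-! ### families -/

/-- `F(m0 + t m1 + z q)` as a polynomial in `z` (outer variable) and `t` (inner variable). -/
def fam {S : Type*} [CommRing S] (F : MvPolynomial (Fin 3) S) (m0 m1 q : Fin 3 → S) : S[X][X] :=
  MvPolynomial.eval₂ ((C : S[X] →+* S[X][X]).comp C)
    (fun i => C (C (m0 i) + C (m1 i) * X) + C (C (q i)) * X) F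

lemma fam_map {S T : Type*} [CommRing S] [CommRing T] (φ : S →+* T)
    (F : MvPolynomial (Fin 3) S) (m0 m1 q : Fin 3 → S) :
    (fam F m0 m1 q).map (mapRingHom φ) =
      fam (MvPolynomial.map φ F) (fun i => φ (m0 i)) (fun i => φ (m1 i)) (fun i => φ (q i)) := by
  unfold fam
  rw [MvPolynomial.eval₂_map, ← coe_mapRingHom, MvPolynomial.hom_eval₂]
  congr 1
  · ext; simp
  · ext i; simp

lemma fam_eval (F : MvPolynomial (Fin 3) ℂ) (m0 m1 q : Fin 3 → ℂ) (t : ℂ) :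
    (fam F m0 m1 q).map (evalRingHom t) = linePoly F (m0 + t • m1) q := by
  unfold fam linePoly
  rw [← coe_mapRingHom, MvPolynomial.hom_eval₂, MvPolynomial.aeval_def]
  congr 1
  · ext; simp
  · funext i; simp; ring

lemma dsc_fam_eval (k : ℕ) (F : MvPolynomial (Fin 3) ℂ) (m0 m1 q : Fin 3 → ℂ) (t : ℂ) :
    (dsc k (fam F m0 m1 q)).eval t = dsc k (linePoly F (m0 + t • m1) q) := by
  rw [← fam_eval, dsc_map]; rfl

lemma coeff_fam_eval (j : ℕ) (F : MvPolynomial (Fin 3) ℂ) (m0 m1 q : Fin 3 → ℂ) (t : ℂ) :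
    ((fam F m0 m1 q).coeff j).eval t = (linePoly F (m0 + t • m1) q).coeff j := by
  rw [← fam_eval, coeff_map]; rfl

lemma swap_scale {F : MvPolynomial (Fin 3) ℂ} {d : ℕ} (hF : F.IsHomogeneous d)
    (m0 m1 q : Fin 3 → ℂ) (t : ℂ) (ht : t ≠ 0) :
    (linePoly F (m1 + t • m0) q).comp (C t * X) =
      C (t ^ d) * linePoly F (m0 + t⁻¹ • m1) q := by
  rw [← linePoly_scale hF]
  congr 2
  ext i; simp; field_simp; ring

lemma dsc_fam_degree {F : MvPolynomial (Fin 3) ℂ} {k : ℕ} (hF : F.IsHomogeneous (k + 3))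
    (m0 m1 q : Fin 3 → ℂ) :
    (dsc k (fam F m0 m1 q)).natDegree ≤ k * (k + 5) ∧
    (dsc k (fam F m0 m1 q)).coeff (k * (k + 5)) = dsc k (linePoly F m1 q) := by
  have := reversal (dsc k (fam F m0 m1 q)) (dsc k (fam F m1 m0 q)) (k * (k + 5)) (by
    intro t ht
    rw [dsc_fam_eval, dsc_fam_eval]
    exact dsc_scale k _ _ t ht (swap_scale hF m0 m1 q t ht))
  refine ⟨this.1, ?_⟩
  rw [this.2 _ le_rfl, Nat.sub_self, coeff_zero_eq_eval_zero, dsc_fam_eval]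
  simp

lemma coeff_fam_degree {F : MvPolynomial (Fin 3) ℂ} {d : ℕ} (hF : F.IsHomogeneous d)
    (m0 m1 q : Fin 3 → ℂ) (j e : ℕ) (hj : j + e = d) :
    ((fam F m0 m1 q).coeff j).natDegree ≤ e ∧
    ((fam F m0 m1 q).coeff j).coeff e = (linePoly F m1 q).coeff j := by
  have := reversal ((fam F m0 m1 q).coeff j) ((fam F m1 m0 q).coeff j) e (by
    intro t ht
    rw [coeff_fam_eval, coeff_fam_eval]
    have h := congrArg (fun p => coeff p j) (swap_scale hF m0 m1 q t ht)
    simp only [comp_C_mul_X_coeff, coeff_C_mul] at h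
    rw [← hj, pow_add] at h
    apply mul_right_cancel₀ (pow_ne_zero j ht)
    rw [h]; ring)
  refine ⟨this.1, ?_⟩
  rw [this.2 _ le_rfl, Nat.sub_self, coeff_zero_eq_eval_zero, coeff_fam_eval]
  simp

/-! ### the explicit example -/

/-- The example: `(1 - t²) z^(k+1) + t z^k - (k+1) z + s`. -/
def exPoly {S : Type*} [CommRing S] (k : ℕ) (t s : S) : S[X] :=
  C (1 - t ^ 2) * X ^ (k + 1) + C t * X ^ k - C ((k : S) + 1) * X + C s

lemma exPoly_map {S T : Type*} [CommRing S] [CommRing T] (φ : S →+* T) (k : ℕ) (t s : S) :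
    (exPoly k t s).map φ = exPoly k (φ t) (φ s) := by
  simp [exPoly]

lemma exPoly_natDegree (k : ℕ) (t s : ℂ) : (exPoly k t s).natDegree ≤ k + 1 := by
  unfold exPoly
  refine natDegree_add_le_of_degree_le ((natDegree_sub_le _ _).trans
    (max_le (natDegree_add_le_of_degree_le ?_ ?_) ?_)) ?_
  · exact natDegree_C_mul_X_pow_le _ _
  · exact (natDegree_C_mul_X_pow_le _ _).trans (by omega)
  · exact (natDegree_C_mul_le _ _).trans (by simp)
  · simp

lemma exPoly_coeff_top (k : ℕ) (hk : k ≠ 0) (t s : ℂ) :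
    (exPoly k t s).coeff (k + 1) = 1 - t ^ 2 := by
  unfold exPoly
  simp only [coeff_add, coeff_sub, coeff_C_mul, coeff_X_pow, coeff_X, coeff_C]
  simp [hk]

lemma exPoly_coeff_k (k : ℕ) (hk : k ≠ 0) (t s : ℂ) :
    (exPoly k t s).coeff k = t - if k = 1 then 2 else 0 := by
  unfold exPoly
  by_cases h : k = 1
  · subst h
    simp only [coeff_add, coeff_sub, coeff_C_mul, coeff_X_pow, coeff_X, coeff_C]
    simp
    norm_num
  · simp only [coeff_add, coeff_sub, coeff_C_mul, coeff_X_pow, coeff_X, coeff_C]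
    simp [hk, h, Ne.symm h]

lemma exPoly_nondeg (k : ℕ) (hk : k ≠ 0) (t s : ℂ) :
    (exPoly k t s).coeff (k + 1) ≠ 0 ∨ (exPoly k t s).coeff k ≠ 0 := by
  rw [exPoly_coeff_top k hk, exPoly_coeff_k k hk]
  by_contra! hcon
  obtain ⟨h1, h2⟩ := hcon
  split_ifs at h2
  · have : t = 2 := by linear_combination h2
    subst this; norm_num at h1
  · have : t = 0 := by linear_combination h2
    subst this; norm_num at h1

lemma exPoly_eval (k : ℕ) (t s z : ℂ) :
    (exPoly k t s).eval z = (exPoly k t 0).eval z + s := by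
  simp [exPoly]

lemma exPoly_derivative (k : ℕ) (t s : ℂ) :
    derivative (exPoly k t s) = derivative (exPoly k t 0) := by
  simp [exPoly]

lemma exPoly_derivative_ne (k : ℕ) (hk : k ≠ 0) (t : ℂ) :
    derivative (exPoly k t 0) ≠ 0 := by
  intro h
  have h1 := coeff_derivative (exPoly k t 0) k
  have h2 := coeff_derivative (exPoly k t 0) (k - 1)
  rw [Nat.sub_add_cancel (Nat.pos_of_ne_zero hk)] at h2
  rw [h, coeff_zero, eq_comm, mul_eq_zero] at h1 h2
  have e1 : (k : ℂ) + 1 ≠ 0 := by exact_mod_cast Nat.succ_ne_zero k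
  have e2 : ((k - 1 : ℕ) : ℂ) + 1 ≠ 0 := by exact_mod_cast Nat.succ_ne_zero (k - 1)
  have := exPoly_nondeg k hk t 0
  tauto

lemma ex_claim3 (k : ℕ) (hk : k ≠ 0) (t : ℂ) : ∃ s, dsc k (exPoly k t s) ≠ 0 := by
  classical
  obtain ⟨s, hs⟩ := Infinite.exists_notMem_finset
    ((derivative (exPoly k t 0)).roots.toFinset.image (fun z => - (exPoly k t 0).eval z))
  refine ⟨s, fun h => hs ?_⟩
  rw [dsc_iff k _ (exPoly_natDegree k t s) (exPoly_nondeg k hk t s)] at h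
  obtain ⟨z, hz, hz'⟩ := h
  rw [exPoly_derivative] at hz'
  rw [exPoly_eval] at hz
  simp only [Finset.mem_image, Multiset.mem_toFinset]
  exact ⟨z, (mem_roots (exPoly_derivative_ne k hk t)).2 hz', by linear_combination -hz⟩

lemma ex_eval (k : ℕ) (t s : ℂ) :
    (dsc k (exPoly k (C t) (X : ℂ[X]))).eval s = dsc k (exPoly k t s) := by
  have := dsc_map (evalRingHom s) k (exPoly k (C t) (X : ℂ[X]))
  rw [exPoly_map] at this
  simp at this
  exact this.symm

lemma ex_product (k : ℕ) (hk : k ≠ 0) (t : ℂ) (ht : 1 - t ^ 2 ≠ 0) :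
    ∃ c : ℂ, c ≠ 0 ∧ dsc k (exPoly k (C t) (X : ℂ[X])) =
      C c * (((derivative (exPoly k t 0)).roots.map (fun z => - (exPoly k t 0).eval z)).map
        (fun a => X - C a)).prod := by
  have e1 : (k : ℂ) + 1 ≠ 0 := by exact_mod_cast Nat.succ_ne_zero k
  refine ⟨(-1) ^ (k * k) * ((((k : ℂ) + 1) * (1 - t ^ 2)) ^ k *
    ((k : ℂ) + 1) ^ (derivative (exPoly k t 0)).roots.card), ?_, ?_⟩
  · refine mul_ne_zero (by simp) (mul_ne_zero (pow_ne_zero _ (mul_ne_zero e1 ht)) (pow_ne_zero _ e1))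
  · apply Polynomial.funext
    intro s
    rw [ex_eval, dsc_prod k _ (exPoly_natDegree k t s) (by rwa [exPoly_coeff_top k hk]),
      exPoly_coeff_top k hk, exPoly_derivative]
    rw [eval_mul, eval_C, eval_multiset_prod, Multiset.map_map, Multiset.map_map,
      Multiset.prod_map_mul]
    simp only [Multiset.map_const', Multiset.prod_replicate]
    rw [mul_assoc, mul_assoc]
    congr 4
    apply Multiset.map_congr rfl
    intro z _
    rw [exPoly_eval]
    simp; ring

lemma ex_degree (k : ℕ) (hk : k ≠ 0) (t : ℂ) (ht : 1 - t ^ 2 ≠ 0) :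
    (dsc k (exPoly k (C t) (X : ℂ[X]))).natDegree = k := by
  obtain ⟨c, hc, h⟩ := ex_product k hk t ht
  rw [h, natDegree_C_mul hc, natDegree_multiset_prod_X_sub_C_eq_card, Multiset.card_map,
    ← (IsAlgClosed.splits (derivative (exPoly k t 0))).natDegree_eq_card_roots]
  apply le_antisymm
  · exact (natDegree_derivative_le _).trans (by have := exPoly_natDegree k t 0; omega)
  · apply le_natDegree_of_ne_zero
    rw [coeff_derivative, exPoly_coeff_top k hk]
    exact mul_ne_zero ht (by exact_mod_cast Nat.succ_ne_zero k)

lemma ex_squarefree (k : ℕ) (hk : k ≠ 0) :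
    Squarefree (dsc k (exPoly k (C 0) (X : ℂ[X]))) := by
  have e1 : (k : ℂ) + 1 ≠ 0 := by exact_mod_cast Nat.succ_ne_zero k
  have e0 : (k : ℂ) ≠ 0 := by exact_mod_cast hk
  obtain ⟨c, hc, h⟩ := ex_product k hk 0 (by simp)
  have hd : derivative (exPoly k (0 : ℂ) 0) = C ((k : ℂ) + 1) * (X ^ k - 1) := by
    simp [exPoly]; ring
  have hsep : (X ^ k - 1 : ℂ[X]).Separable := by
    rw [X_pow_sub_one_separable_iff]; exact e0
  have hnd : (derivative (exPoly k (0 : ℂ) 0)).roots.Nodup := by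
    rw [hd, roots_C_mul _ e1]
    exact nodup_roots hsep
  rw [h]
  set P := (((derivative (exPoly k (0:ℂ) 0)).roots.map (fun z => - (exPoly k (0:ℂ) 0).eval z)).map
        (fun a => X - C a)).prod with hP
  have hPs : P.Separable := by
    have hP0 : P ≠ 0 := (monic_multiset_prod_of_monic _ _ (fun a _ => monic_X_sub_C a)).ne_zero
    rw [← nodup_roots_iff_of_splits hP0 (IsAlgClosed.splits _), hP, roots_multiset_prod_X_sub_C]
    apply Multiset.Nodup.map_on _ hnd
    have key : ∀ z ∈ (derivative (exPoly k (0 : ℂ) 0)).roots,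
        - (exPoly k (0:ℂ) 0).eval z = k * z := by
      intro z hz
      have := isRoot_of_mem_roots hz
      rw [hd, IsRoot] at this
      simp [e1] at this
      have hz : z ^ k = 1 := by linear_combination this
      simp [exPoly, pow_succ, hz]; ring
    intro x hx y hy hxy
    rw [key x hx, key y hy] at hxy
    exact mul_left_cancel₀ e0 hxy
  have := hPs.squarefree
  refine (Associated.squarefree_iff ?_).1 this
  exact (associated_isUnit_mul_left_iff (by simpa using hc) |>.2 (Associated.refl _)).symm

/-! ### a generic member of the example family has squarefree discriminant -/

/-- The discriminant of the example family, as a polynomial in `s` (inner) and `t` (outer). -/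
def exG (k : ℕ) : ℂ[X][X] := dsc k (exPoly k (X : ℂ[X][X]) (C X + X ^ (k + 3)))

/-- The discriminant of `exPoly`, as a polynomial in `t` (inner) and `s` (outer). -/
def exE (k : ℕ) : ℂ[X][X] := dsc k (exPoly k (C X : ℂ[X][X]) X)

/-- The substitution `s ↦ s - t ^ (k+3)`, swapping inner and outer variables. -/
def swapHom (k : ℕ) : ℂ[X][X] →+* ℂ[X][X] :=
  eval₂RingHom (eval₂RingHom ((C : ℂ[X] →+* ℂ[X][X]).comp C) (X - C (X ^ (k + 3)))) (C X)

lemma swapHom_G (k : ℕ) : swapHom k (exG k) = exE k := by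
  unfold exG exE
  rw [← dsc_map, exPoly_map]
  congr 2
  · simp [swapHom]
  · simp [swapHom]

lemma swapHom_eval (k : ℕ) (P : ℂ[X][X]) (t s : ℂ) :
    ((swapHom k P).eval (C s)).eval t = (P.eval (C t)).eval (s - t ^ (k + 3)) := by
  have : ((evalRingHom t).comp (evalRingHom (C s))).comp (swapHom k) =
      (evalRingHom (s - t ^ (k + 3))).comp (evalRingHom (C t)) := by
    apply Polynomial.ringHom_ext'
    · apply Polynomial.ringHom_ext'
      · ext a; simp [swapHom]
      · simp [swapHom]
    · simp [swapHom]
  exact congrArg (fun f => f P) this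

lemma exE_map (k : ℕ) (t : ℂ) :
    (exE k).map (evalRingHom t) = dsc k (exPoly k (C t) (X : ℂ[X])) := by
  unfold exE
  rw [← coe_mapRingHom, ← dsc_map, exPoly_map]
  simp

lemma exE_natDegree (k : ℕ) (hk : k ≠ 0) : (exE k).natDegree = k := by
  have h0 : (exE k) ≠ 0 := by
    intro h
    have h1 := exE_map k 0
    have h2 := ex_degree k hk 0 (by simp)
    rw [← h1, h] at h2
    simp at h2
    exact hk h2.symm
  have hne : (exE k).leadingCoeff * (1 - X ^ 2) ≠ 0 := by
    refine mul_ne_zero (leadingCoeff_ne_zero.2 h0) ?_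
    intro h
    have := congrArg (eval 0) h
    simp at this
  obtain ⟨t, ht⟩ : ∃ t, ((exE k).leadingCoeff * (1 - X ^ 2)).eval t ≠ 0 := by
    by_contra! hcon
    exact hne (Polynomial.funext (by simpa using hcon))
  rw [eval_mul] at ht
  have h1 := left_ne_zero_of_mul ht
  have h2 : 1 - t ^ 2 ≠ 0 := by simpa using right_ne_zero_of_mul ht
  have h3 := ex_degree k hk t h2
  rw [← exE_map, natDegree_map_of_leadingCoeff_ne_zero _ h1] at h3
  exact h3

lemma no_square (k : ℕ) (hk : k ≠ 0) (P : ℂ[X][X]) (hP : P.Monic) (hdeg : P.natDegree ≠ 0)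
    (hdvd : P * P ∣ exG k) : False := by
  obtain ⟨R, hR⟩ := hdvd
  have hE : exE k = swapHom k P * swapHom k P * swapHom k R := by
    rw [← swapHom_G, hR]; simp
  set P' := swapHom k P with hP'
  set R' := swapHom k R
  have hEd := exE_natDegree k hk
  have hE0 : exE k ≠ 0 := by
    intro h; rw [h] at hEd; simp at hEd; exact hk hEd.symm
  have hP0 : P' ≠ 0 := by rintro h; rw [h] at hE; simp at hE; exact hE0 hE
  have hR0 : R' ≠ 0 := by rintro h; rw [h] at hE; simp at hE; exact hE0 hE
  have hm := congrArg (Polynomial.map (evalRingHom (0 : ℂ))) hE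
  rw [Polynomial.map_mul, Polynomial.map_mul, exE_map] at hm
  have hd0 := ex_degree k hk 0 (by simp)
  have hsq := ex_squarefree k hk
  have hm0 := hsq.ne_zero
  have hu : IsUnit (P'.map (evalRingHom (0 : ℂ))) := hsq _ ⟨_, hm⟩
  have hP00 := hu.ne_zero
  have hR00 : R'.map (evalRingHom (0 : ℂ)) ≠ 0 := by
    intro h; rw [h] at hm; simp only [mul_zero] at hm; exact hm0 hm
  have d1 := congrArg natDegree hE
  rw [natDegree_mul (mul_ne_zero hP0 hP0) hR0, natDegree_mul hP0 hP0, hEd] at d1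
  have d2 := congrArg natDegree hm
  rw [natDegree_mul (mul_ne_zero hP00 hP00) hR00, natDegree_mul hP00 hP00, hd0,
    natDegree_eq_zero_of_isUnit hu] at d2
  have d3 : (R'.map (evalRingHom (0 : ℂ))).natDegree ≤ R'.natDegree := natDegree_map_le
  have d4 : P'.natDegree = 0 := by omega
  obtain ⟨p, hp⟩ := natDegree_eq_zero.1 d4
  have hval : ∀ s t : ℂ, (P.eval (C t)).eval s = p.eval t := by
    intro s t
    have := swapHom_eval k P t (s + t ^ (k + 3))
    rw [← hP', ← hp] at this
    simpa using this.symm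
  have hmon : (P.map (evalRingHom (0 : ℂ))).Monic := hP.map _
  have hdg : (P.map (evalRingHom (0 : ℂ))).natDegree = P.natDegree := hP.natDegree_map _
  obtain ⟨t, ht⟩ := IsAlgClosed.exists_root (P.map (evalRingHom (0 : ℂ))) (by
    rw [degree_eq_natDegree hmon.ne_zero, hdg]
    exact_mod_cast hdeg)
  have ht' : (P.eval (C t)).eval 0 = 0 := by
    rw [IsRoot] at ht
    have := Polynomial.map_evalRingHom_eval (0 : ℂ) t P
    rw [ht] at this
    exact this.symm
  obtain ⟨s, hs⟩ := ex_claim3 k hk t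
  apply hs
  rw [← ex_eval, ← exE_map, map_evalRingHom_eval, evalEval, hE, eval_mul, eval_mul, eval_mul,
    eval_mul, hP', swapHom_eval, hval, ← hval 0 t, ht']
  simp

lemma exG_resultant_ne (k : ℕ) (hk : k ≠ 0) (N : ℕ) (hN : N ≠ 0) (c : ℂ) (hc : c ≠ 0)
    (h1 : (exG k).natDegree ≤ N) (h2 : (exG k).coeff N = C c) :
    resultant (exG k) (derivative (exG k)) N (N - 1) ≠ 0 := by
  intro h0
  set G := exG k with hG
  have hCc : (C c : ℂ[X]) ≠ 0 := by simpa using hc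
  have hGd : G.natDegree = N := le_antisymm h1 (le_natDegree_of_ne_zero (by rw [h2]; exact hCc))
  let K := FractionRing ℂ[X]
  let ι := algebraMap ℂ[X] K
  have hι : Function.Injective ι := IsFractionRing.injective _ _
  have hKd : (G.map ι).natDegree = N := by rw [natDegree_map_eq_of_injective hι, hGd]
  have hKd' : (derivative (G.map ι)).natDegree = N - 1 := by
    rw [natDegree_derivative, hKd]
  have hr : resultant (G.map ι) (derivative (G.map ι)) = 0 := by
    rw [hKd, hKd', Polynomial.derivative_map, resultant_map_map, h0, map_zero]
  have hns : ¬ (G.map ι).Separable := (resultant_eq_zero_iff.1 hr).2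
  rw [PerfectField.separable_iff_squarefree] at hns
  unfold Squarefree at hns
  push Not at hns
  obtain ⟨P, hPd, hPu⟩ := hns
  set G1 := C (C c⁻¹) * G with hG1
  have hG1m : G1.Monic := by
    rw [Monic, leadingCoeff, hG1, natDegree_C_mul (by simpa using hc), hGd, coeff_C_mul, h2,
      ← C_mul, inv_mul_cancel₀ hc, C_1]
  have hP1 : P * P ∣ G1.map ι := by
    rw [hG1, Polynomial.map_mul]; exact hPd.mul_left _
  obtain ⟨P', hP'⟩ := IsIntegrallyClosed.eq_map_mul_C_of_dvd K hG1m ((dvd_mul_right P P).trans hP1)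
  have hP0 : P ≠ 0 := by
    rintro rfl
    rw [zero_mul, zero_dvd_iff] at hP1
    exact (hG1m.map ι).ne_zero hP1
  have hlc : P.leadingCoeff ≠ 0 := leadingCoeff_ne_zero.2 hP0
  have hP'm : P'.Monic := by
    apply monic_of_injective hι
    have := congrArg leadingCoeff hP'
    rw [leadingCoeff_mul, leadingCoeff_C] at this
    exact mul_right_cancel₀ hlc (by rw [this, one_mul])
  apply no_square k hk P' hP'm
  · intro hd
    have : P' = 1 := eq_one_of_monic_natDegree_zero hP'm hd
    rw [this, Polynomial.map_one, one_mul] at hP'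
    apply hPu
    have hu := isUnit_C.2 (isUnit_iff_ne_zero.2 hlc)
    rwa [hP'] at hu
  · have hdv : (P' * P').map ι ∣ G1.map ι := by
      rw [Polynomial.map_mul]
      refine (mul_dvd_mul ?_ ?_).trans hP1 <;> exact ⟨_, hP'.symm⟩
    rw [map_dvd_map ι hι (hP'm.mul hP'm)] at hdv
    refine hdv.trans ⟨C (C c), ?_⟩
    rw [hG1, mul_comm, ← mul_assoc, ← C_mul, ← C_mul, mul_inv_cancel₀ hc]; simp [hG]

/-! ### the example as a ternary form -/

section example_form

variable (b : Module.Basis (Fin 3) ℂ (Fin 3 → ℂ))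

/-- The coordinate functions of a basis as linear forms. -/
def lf (j : Fin 3) : MvPolynomial (Fin 3) ℂ :=
  ∑ i, MvPolynomial.C (b.repr (Pi.single i 1) j) * MvPolynomial.X i

lemma lf_homog (j : Fin 3) : (lf b j).IsHomogeneous 1 := by
  apply MvPolynomial.IsHomogeneous.sum
  intro i _
  simpa using (MvPolynomial.isHomogeneous_C (Fin 3) _).mul (MvPolynomial.isHomogeneous_X ℂ i)

lemma lf_dot (j : Fin 3) (v : Fin 3 → ℂ) :
    ∑ i, b.repr (Pi.single i 1) j * v i = b.repr v j := by
  have h : v = ∑ i, v i • (Pi.single i 1 : Fin 3 → ℂ) := by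
    ext l; simp [Finset.sum_apply, Pi.single_apply]
  conv_rhs => rw [h]
  rw [map_sum, Finsupp.finsetSum_apply]
  apply Finset.sum_congr rfl
  intro i _
  rw [map_smul, Finsupp.smul_apply, smul_eq_mul, mul_comm]

lemma lf_line (j : Fin 3) (u w : Fin 3 → ℂ) :
    MvPolynomial.aeval (fun i => C (u i) + X * C (w i)) (lf b j) =
      C (b.repr u j) + X * C (b.repr w j) := by
  rw [← lf_dot b j u, ← lf_dot b j w]
  simp only [lf, map_sum, map_mul, MvPolynomial.aeval_X, MvPolynomial.aeval_C, mul_add,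
    Finset.sum_add_distrib, Finset.mul_sum]
  congr 1
  apply Finset.sum_congr rfl
  intro i _
  simp; ring

lemma lf_fam (j : Fin 3) (m0 m1 q : Fin 3 → ℂ) :
    MvPolynomial.eval₂Hom ((C : ℂ[X] →+* ℂ[X][X]).comp C)
    (fun i => C (C (m0 i) + C (m1 i) * X) + C (C (q i)) * X) (lf b j) =
      C (C (b.repr m0 j) + C (b.repr m1 j) * X) + C (C (b.repr q j)) * X := by
  rw [← lf_dot b j m0, ← lf_dot b j m1, ← lf_dot b j q]
  simp only [lf, map_sum, map_mul, MvPolynomial.eval₂Hom_X', MvPolynomial.eval₂Hom_C, mul_add,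
    map_add, Finset.sum_add_distrib, Finset.sum_mul, RingHom.comp_apply]
  simp only [mul_assoc]

/-- The example form. -/
def exF (k : ℕ) (s : ℂ) : MvPolynomial (Fin 3) ℂ :=
  (lf b 0 ^ 2 - lf b 1 ^ 2) * lf b 2 ^ (k + 1) + lf b 0 ^ 2 * lf b 1 * lf b 2 ^ k
    - MvPolynomial.C ((k : ℂ) + 1) * lf b 0 ^ (k + 2) * lf b 2
    + MvPolynomial.C s * lf b 0 ^ (k + 3) + lf b 1 ^ (k + 3)

lemma exF_homog (k : ℕ) (s : ℂ) : (exF b k s).IsHomogeneous (k + 3) := by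
  have h : ∀ j e, (lf b j ^ e).IsHomogeneous e := fun j e => by
    simpa using (lf_homog b j).pow e
  have hC : ∀ c : ℂ, (MvPolynomial.C c : MvPolynomial (Fin 3) ℂ).IsHomogeneous 0 :=
    fun c => MvPolynomial.isHomogeneous_C _ _
  unfold exF
  have a1 := ((h 0 2).sub (h 1 2)).mul (h 2 (k + 1))
  have a2 := ((h 0 2).mul (lf_homog b 1)).mul (h 2 k)
  have a3 := ((hC ((k : ℂ) + 1)).mul (h 0 (k + 2))).mul (lf_homog b 2)
  have a4 := (hC s).mul (h 0 (k + 3))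
  rw [show 2 + (k + 1) = k + 3 by omega] at a1
  rw [show 2 + 1 + k = k + 3 by omega] at a2
  rw [show 0 + (k + 2) + 1 = k + 3 by omega] at a3
  rw [show 0 + (k + 3) = k + 3 by omega] at a4
  exact (((a1.add a2).sub a3).add a4).add (h 1 _)

lemma exF_fam (k : ℕ) (s : ℂ) :
    fam (exF b k s) (b 0) (b 1) (b 2) = exPoly k X (C s + X ^ (k + 3)) := by
  change MvPolynomial.eval₂Hom ((C : ℂ[X] →+* ℂ[X][X]).comp C)
    (fun i => C (C (b 0 i) + C (b 1 i) * X) + C (C (b 2 i)) * X) _ = _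
  have l0 := lf_fam b 0 (b 0) (b 1) (b 2)
  have l1 := lf_fam b 1 (b 0) (b 1) (b 2)
  have l2 := lf_fam b 2 (b 0) (b 1) (b 2)
  unfold exF exPoly
  rw [map_add, map_add, map_sub, map_add, map_mul, map_sub, map_mul, map_mul, map_mul, map_mul,
    map_mul]
  rw [map_pow, map_pow, map_pow, map_pow, map_pow, map_pow, map_pow, l0, l1, l2,
    MvPolynomial.eval₂Hom_C, MvPolynomial.eval₂Hom_C]
  simp only [b.repr_self]
  simp [Finsupp.single_apply]
  ring

lemma exF_line1 (k : ℕ) (s : ℂ) : linePoly (exF b k s) (b 1) (b 2) = 1 - X ^ (k + 1) := by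
  unfold linePoly exF
  simp only [map_add, map_sub, map_mul, map_pow, lf_line, MvPolynomial.aeval_C, b.repr_self]
  simp [Finsupp.single_apply]
  ring

lemma exF_sing (k : ℕ) (s : ℂ) (i : Fin 3) :
    MvPolynomial.eval (b 2) (MvPolynomial.pderiv i (exF b k s)) = 0 := by
  have h := coeff_one_linePoly (exF b k s) (b 2) (Pi.single i 1)
  have h2 : ∑ j, (Pi.single i 1 : Fin 3 → ℂ) j *
      MvPolynomial.eval (b 2) (MvPolynomial.pderiv j (exF b k s)) =
      MvPolynomial.eval (b 2) (MvPolynomial.pderiv i (exF b k s)) := by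
    simp [Pi.single_apply]
  rw [← h2, ← h]
  have hd : X ^ 2 ∣ linePoly (exF b k s) (b 2) (Pi.single i 1) := by
    unfold linePoly exF
    simp only [map_add, map_sub, map_mul, map_pow, lf_line, MvPolynomial.aeval_C, b.repr_self]
    simp only [Finsupp.single_apply]
    simp only [show ¬ ((2 : Fin 3) = 0) by decide, show ¬ ((2 : Fin 3) = 1) by decide, if_false,
      C_0, zero_add, mul_pow]
    refine dvd_add (dvd_add (dvd_sub (dvd_add (Dvd.dvd.mul_right (dvd_sub ?_ ?_) _) ?_) ?_) ?_) ?_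
    · exact dvd_mul_right _ _
    · exact dvd_mul_right _ _
    · exact ((dvd_mul_right _ _).mul_right _).mul_right _
    · exact (((pow_dvd_pow X (by omega)).mul_right _).mul_left _).mul_right _
    · exact ((pow_dvd_pow X (by omega)).mul_right _).mul_left _
    · exact (pow_dvd_pow X (by omega)).mul_right _
  rw [X_pow_dvd_iff] at hd
  exact hd 1 (by norm_num)

lemma dsc_line1 (k : ℕ) : dsc k (1 - X ^ (k + 1) : ℂ[X]) ≠ 0 := by
  have e1 : (k : ℂ) + 1 ≠ 0 := by exact_mod_cast Nat.succ_ne_zero k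
  have hc : (1 - X ^ (k + 1) : ℂ[X]).coeff (k + 1) ≠ 0 := by
    simp [coeff_one]
  intro h
  rw [dsc_iff k _ ?_ (Or.inl hc)] at h
  · obtain ⟨z, h1, h2⟩ := h
    simp [e1] at h1 h2
    rw [pow_succ] at h1
    obtain ⟨h2, -⟩ := h2
    rw [h2] at h1
    simp at h1
  · refine (natDegree_sub_le _ _).trans (by simp)

lemma exG_map (k : ℕ) (s : ℂ) :
    (exG k).map (evalRingHom s) = dsc k (fam (exF b k s) (b 0) (b 1) (b 2)) := by
  rw [exF_fam]
  unfold exG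
  rw [← coe_mapRingHom, ← dsc_map, exPoly_map]
  simp

lemma exG_natDegree (k : ℕ) : (exG k).natDegree ≤ k * (k + 5) := by
  rw [natDegree_le_iff_coeff_eq_zero]
  intro j hj
  apply Polynomial.funext
  intro s
  have h := exG_map (Pi.basisFun ℂ (Fin 3)) k s
  have h2 := congrArg (fun p => coeff p j) h
  simp only [coeff_map, coe_evalRingHom] at h2
  rw [h2, coeff_eq_zero_of_natDegree_lt ((dsc_fam_degree (exF_homog _ k s) _ _ _).1.trans_lt hj)]
  simp

lemma exG_coeff (k : ℕ) : (exG k).coeff (k * (k + 5)) = C (dsc k (1 - X ^ (k + 1) : ℂ[X])) := by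
  apply Polynomial.funext
  intro s
  have h := exG_map (Pi.basisFun ℂ (Fin 3)) k s
  have h2 := congrArg (fun p => coeff p (k * (k + 5))) h
  simp only [coeff_map, coe_evalRingHom] at h2
  rw [h2, (dsc_fam_degree (exF_homog _ k s) _ _ _).2, exF_line1, eval_C]

lemma exists_s (k : ℕ) : ∃ s : ℂ, s ≠ 0 ∧
    resultant (dsc k (fam (exF b k s) (b 0) (b 1) (b 2)))
      (derivative (dsc k (fam (exF b k s) (b 0) (b 1) (b 2)))) (k * (k + 5)) (k * (k + 5) - 1)
      ≠ 0 := by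
  rcases Nat.eq_zero_or_pos k with rfl | hk
  · refine ⟨1, one_ne_zero, ?_⟩
    simp [resultant]
  · have hne := exG_resultant_ne k hk.ne' (k * (k + 5)) (by positivity) _ (dsc_line1 k)
      (exG_natDegree k) (exG_coeff k)
    obtain ⟨s, hs⟩ : ∃ s, ((X : ℂ[X]) * resultant (exG k) (derivative (exG k)) (k * (k + 5))
        (k * (k + 5) - 1)).eval s ≠ 0 := by
      by_contra! hcon
      exact mul_ne_zero X_ne_zero hne (Polynomial.funext (by simpa using hcon))
    rw [eval_mul, eval_X] at hs
    refine ⟨s, left_ne_zero_of_mul hs, ?_⟩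
    rw [← exG_map, Polynomial.derivative_map, resultant_map_map]
    exact right_ne_zero_of_mul hs

end example_form

/-! ### resultants and common roots -/

lemma resultant_ne_of_no_common (p r : ℂ[X]) (m n : ℕ) (hp : p.natDegree = m)
    (hr : r.natDegree ≤ n) (h : ∀ t, ¬ (p.eval t = 0 ∧ r.eval t = 0)) (hp0 : p ≠ 0) :
    resultant p r m n ≠ 0 := by
  subst hp
  rw [resultant_eq_prod_eval p r n hr (IsAlgClosed.splits p)]
  refine mul_ne_zero (pow_ne_zero _ (leadingCoeff_ne_zero.2 hp0)) ?_
  intro hz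
  rw [Multiset.prod_eq_zero_iff, Multiset.mem_map] at hz
  obtain ⟨t, ht, h0⟩ := hz
  exact h t ⟨isRoot_of_mem_roots ht, h0⟩

lemma no_common_of_resultant_ne (p r : ℂ[X]) (m n : ℕ) (hp : p.natDegree = m)
    (hr : r.natDegree ≤ n) (h : resultant p r m n ≠ 0) (hp0 : p ≠ 0) (t : ℂ) :
    ¬ (p.eval t = 0 ∧ r.eval t = 0) := by
  subst hp
  rw [resultant_eq_prod_eval p r n hr (IsAlgClosed.splits p)] at h
  rintro ⟨h1, h2⟩
  apply h
  rw [mul_eq_zero]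
  right
  rw [Multiset.prod_eq_zero_iff, Multiset.mem_map]
  exact ⟨t, (mem_roots hp0).2 h1, h2⟩

lemma exF_nondeg (b : Module.Basis (Fin 3) ℂ (Fin 3 → ℂ)) (k : ℕ) (s : ℂ) (hs : s ≠ 0) :
    resultant ((fam (exF b k s) (b 0) (b 1) (b 2)).coeff (k + 1))
      ((fam (exF b k s) (b 0) (b 1) (b 2)).coeff k) 2 3 ≠ 0 := by
  have d2 := coeff_fam_degree (exF_homog b k s) (b 0) (b 1) (b 2) (k + 1) 2 (by omega)
  have d3 := coeff_fam_degree (exF_homog b k s) (b 0) (b 1) (b 2) k 3 (by omega)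
  have hc : (1 - X ^ (k + 1) : ℂ[X]).coeff (k + 1) ≠ 0 := by
    simp [coeff_one]
  rw [exF_line1] at d2
  rw [← d2.2] at hc
  refine resultant_ne_of_no_common _ _ 2 3 (le_antisymm d2.1 (le_natDegree_of_ne_zero hc)) d3.1 ?_
    (fun h => by rw [h] at hc; simp at hc)
  rintro t ⟨h1, h2⟩
  have hm : (fam (exF b k s) (b 0) (b 1) (b 2)).map (evalRingHom t) =
      exPoly k t (s + t ^ (k + 3)) := by
    rw [exF_fam, exPoly_map]; simp
  have e1 := congrArg (fun p => coeff p (k + 1)) hm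
  have e2 := congrArg (fun p => coeff p k) hm
  simp only [coeff_map, coe_evalRingHom] at e1 e2
  rw [h1] at e1
  rw [h2] at e2
  rcases Nat.eq_zero_or_pos k with rfl | hk
  · simp only [exPoly, coeff_add, coeff_sub, coeff_C_mul, coeff_X_pow, coeff_X, coeff_C] at e1 e2
    simp at e1 e2
    subst e1
    simp at e2
    exact hs e2.symm
  · rcases exPoly_nondeg k hk.ne' t (s + t ^ (k + 3)) with h | h
    · exact h e1.symm
    · exact h e2.symm

/-! ### counting -/

lemma indep_pair (b : Module.Basis (Fin 3) ℂ (Fin 3 → ℂ)) (u : Fin 3 → ℂ)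
    (h : b.repr u 0 ≠ 0 ∨ b.repr u 1 ≠ 0) : LinearIndependent ℂ ![u, b 2] := by
  rw [LinearIndependent.pair_iff]
  intro s t hst
  have e0 := congrArg (fun v => b.repr v 0) hst
  have e1 := congrArg (fun v => b.repr v 1) hst
  have e2 := congrArg (fun v => b.repr v 2) hst
  simp at e0 e1 e2
  have hs : s = 0 := by tauto
  subst hs
  simp at e2
  exact ⟨rfl, e2⟩

lemma finrank_pair {u q : Fin 3 → ℂ} (h : LinearIndependent ℂ ![u, q]) :
    Module.finrank ℂ (Submodule.span ℂ {u, q}) = 2 := by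
  have := finrank_span_eq_card h
  rw [Matrix.range_cons, Matrix.range_cons, Matrix.range_empty, Set.union_empty,
    Set.singleton_union] at this
  simpa using this

lemma eq_span_pair {W : Submodule ℂ (Fin 3 → ℂ)} (hW : Module.finrank ℂ W = 2)
    {u q : Fin 3 → ℂ} (hu : u ∈ W) (hq : q ∈ W) (h : LinearIndependent ℂ ![u, q]) :
    Submodule.span ℂ {u, q} = W := by
  apply Submodule.eq_of_le_of_finrank_eq
  · rw [Submodule.span_le]
    rintro x hx
    simp only [Set.mem_insert_iff, Set.mem_singleton_iff] at hx
    rcases hx with rfl | rfl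
    · exact hu
    · exact hq
  · rw [finrank_pair h, hW]

lemma basis_expand (b : Module.Basis (Fin 3) ℂ (Fin 3 → ℂ)) (u : Fin 3 → ℂ) :
    u = b.repr u 0 • b 0 + b.repr u 1 • b 1 + b.repr u 2 • b 2 := by
  have := b.sum_repr u
  rw [Fin.sum_univ_three] at this
  exact this.symm

lemma tangent_count (b : Module.Basis (Fin 3) ℂ (Fin 3 → ℂ)) (k : ℕ)
    (F : MvPolynomial (Fin 3) ℂ) (hF : F.IsHomogeneous (k + 3))
    (hs : ∀ i : Fin 3, MvPolynomial.eval (b 2) (MvPolynomial.pderiv i F) = 0)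
    (h1 : (linePoly F (b 1) (b 2)).coeff (k + 1) ≠ 0)
    (h2 : dsc k (linePoly F (b 1) (b 2)) ≠ 0)
    (h3 : resultant (dsc k (fam F (b 0) (b 1) (b 2)))
      (derivative (dsc k (fam F (b 0) (b 1) (b 2)))) (k * (k + 5)) (k * (k + 5) - 1) ≠ 0)
    (h4 : resultant ((fam F (b 0) (b 1) (b 2)).coeff (k + 1))
      ((fam F (b 0) (b 1) (b 2)).coeff k) 2 3 ≠ 0) :
    (tangentLinesThroughNode F (b 2)).Finite ∧
      (tangentLinesThroughNode F (b 2)).ncard = k * (k + 5) := by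
  classical
  obtain ⟨hD1, hD2⟩ := dsc_fam_degree hF (b 0) (b 1) (b 2)
  set D := dsc k (fam F (b 0) (b 1) (b 2)) with hD
  have hDc : D.coeff (k * (k + 5)) ≠ 0 := by rw [hD2]; exact h2
  have hD0 : D ≠ 0 := fun h => hDc (by rw [h]; simp)
  have hDd : D.natDegree = k * (k + 5) := le_antisymm hD1 (le_natDegree_of_ne_zero hDc)
  have hnd : D.roots.Nodup := by
    rw [Multiset.nodup_iff_count_le_one]
    intro t
    rw [count_roots]
    by_contra! hcon
    rw [one_lt_rootMultiplicity_iff_isRoot hD0] at hcon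
    exact no_common_of_resultant_ne D (derivative D) _ _ hDd
      ((natDegree_derivative_le _).trans (by rw [hDd])) h3 hD0 t hcon
  have hcard : D.roots.toFinset.card = k * (k + 5) := by
    rw [Multiset.toFinset_card_of_nodup hnd,
      ← (IsAlgClosed.splits D).natDegree_eq_card_roots, hDd]
  have d2 := coeff_fam_degree hF (b 0) (b 1) (b 2) (k + 1) 2 (by omega)
  have d3 := coeff_fam_degree hF (b 0) (b 1) (b 2) k 3 (by omega)
  have hnon : ∀ t : ℂ, (linePoly F (b 0 + t • b 1) (b 2)).coeff (k + 1) ≠ 0 ∨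
      (linePoly F (b 0 + t • b 1) (b 2)).coeff k ≠ 0 := by
    intro t
    rw [← coeff_fam_eval, ← coeff_fam_eval]
    have hc : ((fam F (b 0) (b 1) (b 2)).coeff (k + 1)).coeff 2 ≠ 0 := by rw [d2.2]; exact h1
    have := no_common_of_resultant_ne _ _ 2 3 (le_antisymm d2.1 (le_natDegree_of_ne_zero hc)) d3.1
      h4 (fun h => by rw [h] at hc; simp at hc) t
    tauto
  have hroot : ∀ t : ℂ, t ∈ D.roots.toFinset ↔ ∃ z, (linePoly F (b 0 + t • b 1) (b 2)).eval z = 0 ∧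
      (derivative (linePoly F (b 0 + t • b 1) (b 2))).eval z = 0 := by
    intro t
    rw [Multiset.mem_toFinset, mem_roots hD0, IsRoot, hD, dsc_fam_eval,
      dsc_iff k _ (linePoly_natDegree hF hs _) (hnon t)]
  have hinf : ¬ ∃ z, (linePoly F (b 1) (b 2)).eval z = 0 ∧
      (derivative (linePoly F (b 1) (b 2))).eval z = 0 := by
    rw [← dsc_iff k _ (linePoly_natDegree hF hs _) (Or.inl h1)]
    exact h2
  have hrep0 : ∀ t z : ℂ, b.repr (b 0 + t • b 1 + z • b 2) 0 = 1 := by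
    intro t z; simp
  have hset : tangentLinesThroughNode F (b 2) =
      (fun t : ℂ => Submodule.span ℂ {b 0 + t • b 1, b 2}) '' (D.roots.toFinset : Set ℂ) := by
    ext W
    constructor
    · rintro ⟨hW, hq, u, hu, hind, hcon⟩
      have hexp := basis_expand b u
      by_cases hx : b.repr u 0 = 0
      · exfalso
        by_cases hy : b.repr u 1 = 0
        · rw [hx, hy] at hexp
          rw [LinearIndependent.pair_iff] at hind
          have := hind 1 (- b.repr u 2) (by
            conv_lhs => rw [hexp]
            simp)
          simp at this
        · have he : u = b.repr u 1 • (b 1 + (b.repr u 2 / b.repr u 1) • b 2) := by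
            conv_lhs => rw [hexp]
            rw [hx, smul_add, smul_smul, mul_div_cancel₀ _ hy]; simp
          rw [he, contact_smul hF _ _ _ hy, contact_shift] at hcon
          exact hinf ⟨_, hcon⟩
      · have he : u = b.repr u 0 • ((b 0 + (b.repr u 1 / b.repr u 0) • b 1) +
            (b.repr u 2 / b.repr u 0) • b 2) := by
          conv_lhs => rw [hexp]
          rw [smul_add, smul_add, smul_smul, smul_smul, mul_div_cancel₀ _ hx,
            mul_div_cancel₀ _ hx]
        have hcon' := hcon
        rw [he, contact_smul hF _ _ _ hx, contact_shift] at hcon'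
        refine ⟨b.repr u 1 / b.repr u 0, Finset.mem_coe.2 ((hroot _).2 ⟨_, hcon'⟩), ?_⟩
        refine eq_span_pair hW ?_ hq (indep_pair b _ (Or.inl ?_))
        · have hv : b 0 + (b.repr u 1 / b.repr u 0) • b 1 =
              (b.repr u 0)⁻¹ • u - (b.repr u 2 / b.repr u 0) • b 2 := by
            rw [eq_sub_iff_add_eq, eq_inv_smul_iff₀ hx]
            exact he.symm
          rw [hv]
          exact W.sub_mem (W.smul_mem _ hu) (W.smul_mem _ hq)
        · simp
    · rintro ⟨t, ht, rfl⟩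
      obtain ⟨z, hz⟩ := (hroot t).1 (Finset.mem_coe.1 ht)
      refine ⟨finrank_pair (indep_pair b _ (Or.inl (by simp))),
        Submodule.subset_span (by simp), b 0 + t • b 1 + z • b 2, ?_,
        indep_pair b _ (Or.inl (by simp)), (contact_shift F _ _ z).2 hz⟩
      exact Submodule.add_mem _ (Submodule.subset_span (by simp))
        (Submodule.smul_mem _ _ (Submodule.subset_span (by simp)))
  have hinj : Function.Injective (fun t : ℂ => Submodule.span ℂ {b 0 + t • b 1, b 2}) := by
    intro t t' htt
    have hm : b 0 + t • b 1 ∈ Submodule.span ℂ {b 0 + t' • b 1, b 2} := by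
      simp only at htt
      rw [← htt]
      exact Submodule.subset_span (by simp)
    rw [Submodule.mem_span_pair] at hm
    obtain ⟨a, c, hac⟩ := hm
    have e0 := congrArg (fun v => b.repr v 0) hac
    have e1 := congrArg (fun v => b.repr v 1) hac
    simp at e0 e1
    rw [← e1, e0, one_mul]
  rw [hset]
  refine ⟨(Finset.finite_toSet _).image _, ?_⟩
  rw [Set.ncard_image_of_injective _ hinj, Set.ncard_coe_finset, hcard]

/-! ### the universal form -/

/-- The universal form of degree `d`. -/
def univF (d : ℕ) : MvPolynomial (Fin 3) (MvPolynomial (Fin 3 →₀ ℕ) ℂ) :=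
  ∑ m ∈ Finset.finsuppAntidiag Finset.univ d, MvPolynomial.monomial m (MvPolynomial.X m)

lemma univF_map {F : MvPolynomial (Fin 3) ℂ} {d : ℕ} (hF : F.IsHomogeneous d) :
    MvPolynomial.map (MvPolynomial.eval (coeffs1 F)) (univF d) = F := by
  classical
  unfold univF
  rw [map_sum]
  simp only [MvPolynomial.map_monomial, MvPolynomial.eval_X]
  ext m
  rw [MvPolynomial.coeff_sum]
  simp only [MvPolynomial.coeff_monomial, Finset.sum_ite_eq']
  split_ifs with h
  · rfl
  · by_contra hne
    apply h
    have h1 := hF (Ne.symm hne)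
    rw [Finset.mem_finsuppAntidiag]
    refine ⟨?_, Finset.subset_univ _⟩
    rw [← h1, Finsupp.weight_apply, Finsupp.sum_fintype _ _ (by simp)]
    simp

/-- constants in the coefficient ring -/
def cst (v : Fin 3 → ℂ) : Fin 3 → MvPolynomial (Fin 3 →₀ ℕ) ℂ := fun i => MvPolynomial.C (v i)

lemma univ_fam {F : MvPolynomial (Fin 3) ℂ} {d : ℕ} (hF : F.IsHomogeneous d)
    (m0 m1 q : Fin 3 → ℂ) :
    (fam (univF d) (cst m0) (cst m1) (cst q)).map
      (mapRingHom (MvPolynomial.eval (coeffs1 F))) = fam F m0 m1 q := by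
  rw [fam_map, univF_map hF]
  simp [cst]

lemma univ_coeff {F : MvPolynomial (Fin 3) ℂ} {d : ℕ} (hF : F.IsHomogeneous d)
    (m0 m1 q : Fin 3 → ℂ) (j : ℕ) :
    ((fam (univF d) (cst m0) (cst m1) (cst q)).coeff j).map (MvPolynomial.eval (coeffs1 F)) =
      (fam F m0 m1 q).coeff j := by
  rw [← univ_fam hF, coeff_map]; rfl

lemma univ_dsc {F : MvPolynomial (Fin 3) ℂ} {d : ℕ} (hF : F.IsHomogeneous d)
    (m0 m1 q : Fin 3 → ℂ) (k : ℕ) :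
    (dsc k (fam (univF d) (cst m0) (cst m1) (cst q))).map (MvPolynomial.eval (coeffs1 F)) =
      dsc k (fam F m0 m1 q) := by
  rw [← univ_fam hF, dsc_map]; rfl

/-- The polynomial whose nonvanishing is the genericity condition. -/
def genQ (k : ℕ) (m0 m1 q : Fin 3 → ℂ) : MvPolynomial (Fin 3 →₀ ℕ) ℂ :=
  ((fam (univF (k + 3)) (cst m1) (cst m0) (cst q)).coeff (k + 1)).coeff 0 *
  (dsc k (fam (univF (k + 3)) (cst m1) (cst m0) (cst q))).coeff 0 *
  resultant (dsc k (fam (univF (k + 3)) (cst m0) (cst m1) (cst q)))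
    (derivative (dsc k (fam (univF (k + 3)) (cst m0) (cst m1) (cst q))))
    (k * (k + 5)) (k * (k + 5) - 1) *
  resultant ((fam (univF (k + 3)) (cst m0) (cst m1) (cst q)).coeff (k + 1))
    ((fam (univF (k + 3)) (cst m0) (cst m1) (cst q)).coeff k) 2 3

lemma genQ_eval {F : MvPolynomial (Fin 3) ℂ} {k : ℕ} (hF : F.IsHomogeneous (k + 3))
    (m0 m1 q : Fin 3 → ℂ) :
    MvPolynomial.eval (coeffs1 F) (genQ k m0 m1 q) =
      (linePoly F m1 q).coeff (k + 1) * dsc k (linePoly F m1 q) *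
      resultant (dsc k (fam F m0 m1 q)) (derivative (dsc k (fam F m0 m1 q)))
        (k * (k + 5)) (k * (k + 5) - 1) *
      resultant ((fam F m0 m1 q).coeff (k + 1)) ((fam F m0 m1 q).coeff k) 2 3 := by
  have e1 : MvPolynomial.eval (coeffs1 F)
      (((fam (univF (k + 3)) (cst m1) (cst m0) (cst q)).coeff (k + 1)).coeff 0) =
      (linePoly F m1 q).coeff (k + 1) := by
    rw [← coeff_map, univ_coeff hF, coeff_zero_eq_eval_zero, coeff_fam_eval, zero_smul, add_zero]
  have e2 : MvPolynomial.eval (coeffs1 F)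
      ((dsc k (fam (univF (k + 3)) (cst m1) (cst m0) (cst q))).coeff 0) =
      dsc k (linePoly F m1 q) := by
    rw [← coeff_map, univ_dsc hF, coeff_zero_eq_eval_zero, dsc_fam_eval, zero_smul, add_zero]
  have e3 := resultant_map_map (dsc k (fam (univF (k + 3)) (cst m0) (cst m1) (cst q)))
    (derivative (dsc k (fam (univF (k + 3)) (cst m0) (cst m1) (cst q))))
    (k * (k + 5)) (k * (k + 5) - 1) (MvPolynomial.eval (coeffs1 F))
  rw [← Polynomial.derivative_map, univ_dsc hF] at e3
  have e4 := resultant_map_map ((fam (univF (k + 3)) (cst m0) (cst m1) (cst q)).coeff (k + 1))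
    ((fam (univF (k + 3)) (cst m0) (cst m1) (cst q)).coeff k) 2 3 (MvPolynomial.eval (coeffs1 F))
  rw [univ_coeff hF, univ_coeff hF] at e4
  rw [genQ, map_mul, map_mul, map_mul, e1, e2, ← e3, ← e4]

lemma exists_basis (q : Fin 3 → ℂ) (hq : q ≠ 0) :
    ∃ b : Module.Basis (Fin 3) ℂ (Fin 3 → ℂ), b 2 = q := by
  obtain ⟨A, hA⟩ := SeparatingDual.exists_continuousLinearEquiv_apply_eq (R := ℂ)
    (x := (Pi.single 2 1 : Fin 3 → ℂ)) (y := q) (by simp) hq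
  refine ⟨(Pi.basisFun ℂ (Fin 3)).map A.toLinearEquiv, ?_⟩
  simpa using hA

end node_helpers

/-- Fix a point `[q] ∈ ℙ²` and let `d ≥ 3`.  For a general plane curve of degree `d`
singular at `[q]` (the zero locus of a general degree-`d` form all of whose first
partial derivatives vanish at `q`), the number of lines through `[q]` tangent to the
curve at some point distinct from `[q]` is exactly `(d − 3)(d + 2) = d² − d − 6`. -/
theorem tangent_lines_through_node_count (d : ℕ) (hd : 3 ≤ d) (q : Fin 3 → ℂ) (hq : q ≠ 0) :
    ∃ Q : MvPolynomial (Fin 3 →₀ ℕ) ℂ,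
      (∃ F : MvPolynomial (Fin 3) ℂ, F.IsHomogeneous d ∧ F ≠ 0 ∧
          (∀ i : Fin 3, MvPolynomial.eval q (MvPolynomial.pderiv i F) = 0) ∧
          MvPolynomial.eval (coeffs1 F) Q ≠ 0) ∧
      ∀ F : MvPolynomial (Fin 3) ℂ, F.IsHomogeneous d → F ≠ 0 →
        (∀ i : Fin 3, MvPolynomial.eval q (MvPolynomial.pderiv i F) = 0) →
        MvPolynomial.eval (coeffs1 F) Q ≠ 0 →
          (tangentLinesThroughNode F q).Finite ∧
            ((tangentLinesThroughNode F q).ncard : ℤ) = ((d : ℤ) - 3) * ((d : ℤ) + 2) ∧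
            ((d : ℤ) - 3) * ((d : ℤ) + 2) = (d : ℤ) ^ 2 - (d : ℤ) - 6 := by
  obtain ⟨k, rfl⟩ : ∃ k, d = k + 3 := ⟨d - 3, by omega⟩
  obtain ⟨b, rfl⟩ := exists_basis q hq
  refine ⟨genQ k (b 0) (b 1) (b 2), ?_, ?_⟩
  · obtain ⟨s, hs, hres⟩ := exists_s b k
    have hc : (1 - Polynomial.X ^ (k + 1) : Polynomial ℂ).coeff (k + 1) ≠ 0 := by
      simp [Polynomial.coeff_one]
    refine ⟨exF b k s, exF_homog b k s, ?_, exF_sing b k s, ?_⟩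
    · intro h
      have h1 := exF_line1 b k s
      rw [h] at h1
      rw [← h1] at hc
      simp [linePoly] at hc
    · rw [genQ_eval (exF_homog b k s), exF_line1]
      exact mul_ne_zero (mul_ne_zero (mul_ne_zero hc (dsc_line1 k)) hres) (exF_nondeg b k s hs)
  · intro F hF _ hsing hQ
    rw [genQ_eval hF] at hQ
    have h4 := right_ne_zero_of_mul hQ
    have hQ3 := left_ne_zero_of_mul hQ
    have h3 := right_ne_zero_of_mul hQ3
    have hQ2 := left_ne_zero_of_mul hQ3
    obtain ⟨hfin, hcard⟩ := tangent_count b k F hF hsing (left_ne_zero_of_mul hQ2)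
      (right_ne_zero_of_mul hQ2) h3 h4
    refine ⟨hfin, ?_, ?_⟩
    · rw [hcard]; push_cast; ring
    · push_cast; ring
end
end
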